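/- arXiv:1503.00671 — 3 statements merged into one kernel-verified Lean document; each statement's English description precedes it below -/
import Mathlib

section
/- There exist δ ∈ (0,1) and γ > 0 such that for every ε > 0 there exist an open set U ⊂ ℝ³ containing Ω and a smooth function G : U → ℝ with: (i) ∫_{B₁} ∇G(∇u₀)·∇ψ dx = 0 for every ψ ∈ C_c^∞(B₁ ∖ {0}); (ii) S_G(p,q) ≥ γ|p−q|² whenever p ∈ Ω_R satisfies −1+δ ≤ p₁ ≤ 1−δ and q ∈ Ω; (iii) S_G(p,q) ≥ −ε|p−q|² for all p, q ∈ Ω. -/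
open Real Set Metric MeasureTheory
open scoped RealInnerProductSpace

noncomputable section

/-- `u₀(x) = (x₂² + x₃² − x₁²)/(√2·|x|)` (with value `0` at the origin, by `0`-division). -/
def u0 : EuclideanSpace ℝ (Fin 3) → ℝ :=
  fun x => ((x 1) ^ 2 + (x 2) ^ 2 - (x 0) ^ 2) / (Real.sqrt 2 * ‖x‖)

/-- `Ω = ∇u₀(S²)`. -/
def Om : Set (EuclideanSpace ℝ (Fin 3)) :=
  {p | ∃ x : EuclideanSpace ℝ (Fin 3), ‖x‖ = 1 ∧ gradient u0 x = p}

/-- `Ω_R = ∇u₀(S² ∩ {x₁² ≤ x₂² + x₃²})`. -/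
def OmR : Set (EuclideanSpace ℝ (Fin 3)) :=
  {p | ∃ x : EuclideanSpace ℝ (Fin 3), ‖x‖ = 1 ∧ (x 0) ^ 2 ≤ (x 1) ^ 2 + (x 2) ^ 2 ∧
    gradient u0 x = p}

lemma mono_aux {f f' : ℝ → ℝ} {a b : ℝ} (hab : a ≤ b) (hf : ∀ x, HasDerivAt f (f' x) x)
    (h : ∀ x, a ≤ x → x ≤ b → 0 ≤ f' x) : f a ≤ f b := by
  have : MonotoneOn f (Icc a b) := by
    apply monotoneOn_of_deriv_nonneg (convex_Icc a b)
    · exact fun x _ => (hf x).continuousAt.continuousWithinAt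
    · exact fun x _ => (hf x).differentiableAt.differentiableWithinAt
    · intro x hx
      rw [interior_Icc] at hx
      rw [(hf x).deriv]
      exact h x hx.1.le hx.2.le
  exact this (left_mem_Icc.2 hab) (right_mem_Icc.2 hab) hab

/-- primitive vanishing at `0`. -/
def prim (f : ℝ → ℝ) (t : ℝ) : ℝ := ∫ x in (0 : ℝ)..t, f x

lemma prim_zero (f : ℝ → ℝ) : prim f 0 = 0 := by simp [prim]

lemma prim_hasDerivAt {f : ℝ → ℝ} (hf : Continuous f) (t : ℝ) : HasDerivAt (prim f) (f t) t :=
  intervalIntegral.integral_hasDerivAt_right (hf.intervalIntegrable _ _)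
    (hf.stronglyMeasurableAtFilter _ _) hf.continuousAt

lemma prim_contDiff {f : ℝ → ℝ} (hf : ContDiff ℝ (⊤ : ℕ∞) f) : ContDiff ℝ (⊤ : ℕ∞) (prim f) := by
  have h := fun t => prim_hasDerivAt hf.continuous t
  have h2 : deriv (prim f) = f := funext fun t => (h t).deriv
  rw [contDiff_infty_iff_deriv, h2]
  exact ⟨fun t => (h t).differentiableAt, hf⟩

lemma prim_even {f : ℝ → ℝ} (hf : ∀ x, f (-x) = - f x) (t : ℝ) : prim f (-t) = prim f t := by
  have := intervalIntegral.integral_comp_neg (a := 0) (b := t) f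
  simp only [hf, intervalIntegral.integral_neg, neg_zero] at this
  have h2 := intervalIntegral.integral_symm (f := f) (μ := volume) 0 (-t)
  unfold prim
  linarith

lemma prim_odd {f : ℝ → ℝ} (hf : ∀ x, f (-x) = f x) (t : ℝ) : prim f (-t) = - prim f t := by
  have := intervalIntegral.integral_comp_neg (a := 0) (b := t) f
  simp only [hf, neg_zero] at this
  have h2 := intervalIntegral.integral_symm (f := f) (μ := volume) 0 (-t)
  unfold prim
  linarith

lemma smoothTransition_lip : ∃ L : ℝ, 0 ≤ L ∧ ∀ x y : ℝ, x ≤ y →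
    Real.smoothTransition y - Real.smoothTransition x ≤ L * (y - x) := by
  have hc : ContDiff ℝ (1 : ℕ∞) Real.smoothTransition := Real.smoothTransition.contDiff
  have hd : Continuous (deriv Real.smoothTransition) := hc.continuous_deriv (by simp)
  obtain ⟨L, hL⟩ := (isCompact_Icc (a := (0:ℝ)) (b := 1)).exists_bound_of_continuousOn hd.continuousOn
  have hL0 : 0 ≤ L := (norm_nonneg _).trans (hL 0 (by simp))
  have hdd : ∀ x, HasDerivAt Real.smoothTransition (deriv Real.smoothTransition x) x :=
    fun x => (hc.differentiable (by simp) x).hasDerivAt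
  refine ⟨L, hL0, fun x y hxy => ?_⟩
  have key : ∀ x y : ℝ, 0 ≤ x → x ≤ y → y ≤ 1 →
      Real.smoothTransition y - Real.smoothTransition x ≤ L * (y - x) := by
    intro x y hx hxy hy
    have := mono_aux (f := fun u => L * u - Real.smoothTransition u) hxy
      (fun u => ((hasDerivAt_id u).const_mul L).sub (hdd u)) (fun u h1 h2 => by
        have := hL u ⟨by linarith, by linarith⟩
        rw [Real.norm_eq_abs] at this
        have := (abs_le.1 this).2
        simp only [mul_one]; linarith)
    linarith
  rw [← Real.smoothTransition.projIcc (x := x), ← Real.smoothTransition.projIcc (x := y)]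
  have h1 := key (projIcc (0 : ℝ) 1 zero_le_one x) (projIcc (0 : ℝ) 1 zero_le_one y)
    (projIcc (0 : ℝ) 1 zero_le_one x).2.1 (monotone_projIcc _ hxy)
    (projIcc (0 : ℝ) 1 zero_le_one y).2.2
  refine h1.trans (mul_le_mul_of_nonneg_left ?_ hL0)
  simp only [coe_projIcc]
  rcases le_total x 1 with h | h <;> rcases le_total y 1 with h' | h' <;>
  rcases le_total 0 x with h2 | h2 <;> rcases le_total 0 y with h2' | h2' <;>
  simp [h, h', h2, h2'] <;> linarith

/-- slope of the smoothed tent. -/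
def th (u : ℝ) : ℝ := 2 * Real.smoothTransition (100 * u + 1 / 2) - 1

lemma th_contDiff : ContDiff ℝ (⊤ : ℕ∞) th := by
  unfold th
  have : ContDiff ℝ (⊤ : ℕ∞) fun u : ℝ => Real.smoothTransition (100 * u + 1 / 2) :=
    Real.smoothTransition.contDiff.comp (by fun_prop)
  exact (contDiff_const.mul this).sub contDiff_const

lemma th_odd (u : ℝ) : th (-u) = - th u := by
  unfold th
  have h : ∀ x : ℝ, Real.smoothTransition (1 - x) = 1 - Real.smoothTransition x := by
    intro x
    have := Real.smoothTransition.pos_denom x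
    unfold Real.smoothTransition
    rw [show 1 - (1 - x) = x by ring, add_comm (expNegInvGlue (1 - x))]
    field_simp
    ring
  rw [show 100 * -u + 1 / 2 = 1 - (100 * u + 1 / 2) by ring, h]
  ring

lemma th_mono : Monotone th := by
  intro a b hab
  unfold th
  have := Real.smoothTransition.monotone (show 100 * a + 1 / 2 ≤ 100 * b + 1 / 2 by linarith)
  linarith

lemma th_one {u : ℝ} (h : 1 / 200 ≤ u) : th u = 1 := by
  unfold th
  rw [Real.smoothTransition.one_of_one_le (by linarith)]; norm_num

lemma th_le (u : ℝ) : th u ≤ 1 := by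
  unfold th; linarith [Real.smoothTransition.le_one (100 * u + 1 / 2)]

lemma th_zero : th 0 = 0 := by have := th_odd 0; simp at this; linarith

lemma th_nonneg {u : ℝ} (h : 0 ≤ u) : 0 ≤ th u := th_zero ▸ th_mono h

/-- the smoothed tent. -/
def tent (t : ℝ) : ℝ := prim th 1 - prim th t

lemma tent_hasDerivAt (t : ℝ) : HasDerivAt tent (- th t) t := by
  have := (prim_hasDerivAt th_contDiff.continuous t).const_sub (prim th 1)
  exact this

lemma tent_contDiff : ContDiff ℝ (⊤ : ℕ∞) tent :=
  contDiff_const.sub (prim_contDiff th_contDiff)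

lemma tent_even (t : ℝ) : tent (-t) = tent t := by
  unfold tent; rw [prim_even th_odd]

lemma tent_abs (t : ℝ) : tent |t| = tent t := by
  rcases abs_choice t with h | h <;> rw [h]
  exact tent_even t

lemma tent_one : tent 1 = 0 := by simp [tent]

lemma tent_anti {s t : ℝ} (hs : 0 ≤ s) (hst : s ≤ t) : tent t ≤ tent s := by
  have := mono_aux (f := fun u => - tent u) hst (fun u => (tent_hasDerivAt u).neg)
    (fun u h _ => by have := th_nonneg (hs.trans h); linarith)
  linarith

lemma tent_nonneg {t : ℝ} (h : |t| ≤ 1) : 0 ≤ tent t := by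
  rw [← tent_abs, ← tent_one]
  exact tent_anti (abs_nonneg _) h

lemma tent_le {t : ℝ} (h : |t| ≤ 1) : tent t ≤ 1 - |t| := by
  have := mono_aux (f := fun u => tent u + u) h
    (fun u => (tent_hasDerivAt u).add (hasDerivAt_id u))
    (fun u _ _ => by have := th_le u; linarith)
  simp only [tent_one, tent_abs] at this; linarith

lemma tent_eq {t : ℝ} (h : 1 / 200 ≤ t) (h1 : t ≤ 1) : tent t = 1 - t := by
  have := mono_aux (f := fun u => - (tent u + u)) h1
    (fun u => ((tent_hasDerivAt u).add (hasDerivAt_id u)).neg)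
    (fun u h2 _ => by have := th_one (h.trans h2); linarith)
  have h3 := tent_le (t := t) (by rw [abs_of_nonneg (by linarith)]; exact h1)
  rw [abs_of_nonneg (by linarith)] at h3
  simp only [tent_one] at this; linarith

lemma tent_trapezoid {s t : ℝ} (hst : s ≤ t) :
    (t - s) * (tent t + tent s) ≤ 2 * (prim tent t - prim tent s) := by
  have h1 : ∀ u, s ≤ u → tent s - tent u ≤ (u - s) * th u := by
    intro u hu
    have := mono_aux (f := fun x => x * th u + tent x) hu
      (fun x => ((hasDerivAt_id x).mul_const (th u)).add (tent_hasDerivAt x))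
      (fun x _ h2 => by have := th_mono h2; linarith)
    linarith
  have := mono_aux (f := fun u => 2 * (prim tent u) - (u - s) * (tent u + tent s)) hst
    (fun u => ((prim_hasDerivAt tent_contDiff.continuous u).const_mul 2).sub
      (((hasDerivAt_id u).sub_const s).mul ((tent_hasDerivAt u).add_const (tent s))))
    (fun u h _ => by have := h1 u h; simp only [id]; linarith)
  linarith

/-- properties of the radial profile. -/
structure VP (ε η : ℝ) (v : ℝ → ℝ) : Prop where
  smooth : ContDiff ℝ (⊤ : ℕ∞) v
  even : ∀ t, v (-t) = v t
  nonneg : ∀ t, 0 ≤ v t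
  eta_pos : 0 < η
  eta_lt : η < 1
  zero : ∀ t, 1 - η ≤ |t| → v t = 0
  anti : ∀ s t, |s| ≤ |t| → v t ≤ v s
  le_one : ∀ t, v t ≤ 1
  ge : ∀ t, |t| ≤ 1 / 4 → 3 / 4 ≤ v t
  B : ∀ s t, -1 ≤ s → s ≤ t → t ≤ 1 →
    -ε * (1 - s ^ 2) * (t - s) ≤ 2 * (prim v t - prim v s) - (t - s) * v s
  conc : ∀ s, 1 / 200 ≤ s → s ≤ 1 → 2 * (prim v 1 - prim v s) ≤ (1 - s) * v s

/-- logarithmic cutoff. -/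
def cut (e t : ℝ) : ℝ :=
  if |t| < 1 then Real.smoothTransition (2 + e * Real.log (1 - t ^ 2)) else 0

lemma sq_lt_one_of_abs {t : ℝ} (h : |t| < 1) : 0 < 1 - t ^ 2 := by
  have := (sq_lt_one_iff_abs_lt_one t).2 h; linarith

lemma cut_nonneg (e t : ℝ) : 0 ≤ cut e t := by
  unfold cut; split_ifs
  · exact Real.smoothTransition.nonneg _
  · exact le_rfl

lemma cut_le_one (e t : ℝ) : cut e t ≤ 1 := by
  unfold cut; split_ifs
  · exact Real.smoothTransition.le_one _
  · exact zero_le_one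

lemma cut_even (e t : ℝ) : cut e (-t) = cut e t := by
  unfold cut; simp

lemma cut_anti {e : ℝ} (he : 0 < e) {s t : ℝ} (h : |s| ≤ |t|) : cut e t ≤ cut e s := by
  by_cases ht : |t| < 1
  · have hs := h.trans_lt ht
    have h2 : s ^ 2 ≤ t ^ 2 := sq_le_sq.2 h
    unfold cut; rw [if_pos ht, if_pos hs]
    apply Real.smoothTransition.monotone
    have := Real.log_le_log (sq_lt_one_of_abs ht) (show 1 - t ^ 2 ≤ 1 - s ^ 2 by linarith)
    have := mul_le_mul_of_nonneg_left this he.le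
    linarith
  · have : cut e t = 0 := by unfold cut; rw [if_neg ht]
    rw [this]; exact cut_nonneg _ _

lemma cut_zero {e : ℝ} (he : 0 < e) {t : ℝ} (h : 1 - Real.exp (-2 / e) / 2 ≤ |t|) :
    cut e t = 0 := by
  unfold cut; split_ifs with ht
  · apply Real.smoothTransition.zero_of_nonpos
    have h0 := sq_lt_one_of_abs ht
    have h1 : 1 - t ^ 2 ≤ Real.exp (-2 / e) := by
      rw [← sq_abs]; nlinarith [abs_nonneg t]
    have h2 : Real.log (1 - t ^ 2) ≤ -2 / e := (Real.log_le_iff_le_exp h0).2 h1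
    have h3 : e * Real.log (1 - t ^ 2) ≤ e * (-2 / e) := mul_le_mul_of_nonneg_left h2 he.le
    have h4 : e * (-2 / e) = -2 := by field_simp
    linarith
  · rfl

lemma cut_one {e : ℝ} (he : 0 < e) (he1 : e ≤ 1) {t : ℝ} (h : |t| ≤ 1 / 4) : cut e t = 1 := by
  have ht : |t| < 1 := by linarith
  unfold cut; rw [if_pos ht]
  apply Real.smoothTransition.one_of_one_le
  have h0 := sq_lt_one_of_abs ht
  have h1 : (1 : ℝ) / 2 ≤ 1 - t ^ 2 := by rw [← sq_abs]; nlinarith [abs_nonneg t]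
  have h2 := Real.one_sub_inv_le_log_of_pos h0
  have h3 : (1 - t ^ 2)⁻¹ ≤ 2 := by
    rw [inv_le_comm₀ h0 two_pos]; linarith
  nlinarith

lemma cut_contDiff {e : ℝ} (he : 0 < e) : ContDiff ℝ (⊤ : ℕ∞) (cut e) := by
  rw [contDiff_iff_contDiffAt]
  intro t
  by_cases ht : |t| < 1
  · have h0 := sq_lt_one_of_abs ht
    have h1 : cut e =ᶠ[nhds t] fun t => Real.smoothTransition (2 + e * Real.log (1 - t ^ 2)) := by
      filter_upwards [(isOpen_lt continuous_abs continuous_const).mem_nhds ht] with u hu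
      unfold cut; rw [if_pos hu]
    refine ContDiffAt.congr_of_eventuallyEq ?_ h1
    have h2 : ContDiffAt ℝ (⊤ : ℕ∞) (fun t : ℝ => 2 + e * Real.log (1 - t ^ 2)) t := by
      refine contDiffAt_const.add (contDiffAt_const.mul (ContDiffAt.log ?_ h0.ne'))
      fun_prop
    exact Real.smoothTransition.contDiff.contDiffAt.comp t h2
  · have h1 : cut e =ᶠ[nhds t] fun _ => 0 := by
      have : 1 - Real.exp (-2 / e) / 2 < |t| := by
        have := Real.exp_pos (-2 / e); push Not at ht; linarith
      filter_upwards [(isOpen_lt continuous_const continuous_abs).mem_nhds this] with u hu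
      exact cut_zero he (le_of_lt hu)
    exact contDiffAt_const.congr_of_eventuallyEq h1

lemma exists_VP {ε : ℝ} (hε : 0 < ε) (hε1 : ε ≤ 1) : ∃ η v, VP ε η v := by
  obtain ⟨L, hL0, hL⟩ := smoothTransition_lip
  set e : ℝ := ε / (2 * L + 1) with he_def
  have hL1 : 0 < 2 * L + 1 := by linarith
  have he : 0 < e := div_pos hε hL1
  have heL : e * (2 * L + 1) = ε := by rw [he_def]; field_simp
  have he1 : e ≤ 1 := by nlinarith
  have hcutdiff : ∀ s t, |s| ≤ 1 → |t| ≤ 1 →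
      2 * ((cut e s - cut e t) * tent t) ≤ ε * (1 - s ^ 2) := by
    intro s t hs ht
    have hs2 : 0 ≤ 1 - s ^ 2 := by have := (sq_le_one_iff_abs_le_one s).2 hs; linarith
    have hR : 0 ≤ ε * (1 - s ^ 2) := mul_nonneg hε.le hs2
    have hm := tent_nonneg ht
    rcases le_or_gt |t| |s| with h | h
    · have := cut_anti he h
      have : (cut e s - cut e t) * tent t ≤ 0 := mul_nonpos_of_nonpos_of_nonneg (by linarith) hm
      linarith
    · rcases eq_or_lt_of_le ht with ht1 | ht1
      · have : tent t = 0 := by rw [← tent_abs, ht1, tent_one]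
        rw [this]; simpa using hR
      · have hs1 := h.trans ht1
        have h0t := sq_lt_one_of_abs ht1
        have h0s := sq_lt_one_of_abs hs1
        have hts : 1 - t ^ 2 ≤ 1 - s ^ 2 := by
          have := sq_le_sq.2 h.le; linarith
        have hlog := Real.log_le_log h0t hts
        have h1 : cut e s - cut e t ≤
            L * (e * (Real.log (1 - s ^ 2) - Real.log (1 - t ^ 2))) := by
          unfold cut; rw [if_pos ht1, if_pos hs1]
          refine (hL _ _ ?_).trans (le_of_eq ?_)
          · have := mul_le_mul_of_nonneg_left hlog he.le; linarith
          · ring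
        have h2 : Real.log (1 - s ^ 2) - Real.log (1 - t ^ 2) ≤ (1 - s ^ 2) / (1 - t ^ 2) := by
          rw [← Real.log_div h0s.ne' h0t.ne']
          have := Real.log_le_sub_one_of_pos (div_pos h0s h0t)
          linarith
        have h3 : tent t ≤ 1 - t ^ 2 := by
          have := tent_le ht
          rw [← sq_abs]; nlinarith [abs_nonneg t]
        have h4 : cut e s - cut e t ≤ L * (e * ((1 - s ^ 2) / (1 - t ^ 2))) :=
          h1.trans (by gcongr)
        have h5 : (cut e s - cut e t) * tent t ≤ L * (e * ((1 - s ^ 2) / (1 - t ^ 2))) * (1 - t ^ 2) := by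
          have : 0 ≤ L * (e * ((1 - s ^ 2) / (1 - t ^ 2))) := by positivity
          calc _ ≤ L * (e * ((1 - s ^ 2) / (1 - t ^ 2))) * tent t := by gcongr
            _ ≤ _ := by gcongr
        have h6 : L * (e * ((1 - s ^ 2) / (1 - t ^ 2))) * (1 - t ^ 2) = L * e * (1 - s ^ 2) := by
          field_simp
        rw [h6] at h5
        have : 2 * (L * e) ≤ ε := by nlinarith
        nlinarith
  have hanti : ∀ s t, |s| ≤ |t| → cut e t * tent t ≤ cut e s * tent s := by
    intro s t h
    rcases le_or_gt |t| 1 with ht | ht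
    · have h1 := cut_anti he h
      have h2 : tent t ≤ tent s := by
        rw [← tent_abs t, ← tent_abs s]; exact tent_anti (abs_nonneg _) h
      exact mul_le_mul h1 h2 (tent_nonneg ht) (cut_nonneg _ _)
    · have : cut e t = 0 := by unfold cut; rw [if_neg (by linarith)]
      rw [this, zero_mul]
      rcases le_or_gt |s| 1 with hs | hs
      · exact mul_nonneg (cut_nonneg _ _) (tent_nonneg hs)
      · have : cut e s = 0 := by unfold cut; rw [if_neg (by linarith)]
        rw [this, zero_mul]
  have hnn : ∀ t, 0 ≤ cut e t * tent t := by
    intro t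
    rcases le_or_gt |t| 1 with hs | hs
    · exact mul_nonneg (cut_nonneg _ _) (tent_nonneg hs)
    · have : cut e t = 0 := by unfold cut; rw [if_neg (by linarith)]
      rw [this, zero_mul]
  have hsm : ContDiff ℝ (⊤ : ℕ∞) fun t => cut e t * tent t := (cut_contDiff he).mul tent_contDiff
  have hle : ∀ t, cut e t * tent t ≤ 1 := by
    intro t
    have h := hanti 0 t (by simp)
    have h1 := cut_le_one e 0
    have h2 := tent_le (t := 0) (by simp)
    simp only [abs_zero, sub_zero] at h2
    have h3 := cut_nonneg e 0
    nlinarith [tent_nonneg (t := 0) (by simp)]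
  refine ⟨Real.exp (-2 / e) / 2, fun t => cut e t * tent t, hsm, ?_, hnn, ?_, ?_, ?_, hanti, hle,
    ?_, ?_, ?_⟩
  · intro t; simp only [cut_even, tent_even]
  · have := Real.exp_pos (-2 / e); positivity
  · have : Real.exp (-2 / e) ≤ 1 := by
      rw [Real.exp_le_one_iff]
      exact div_nonpos_of_nonpos_of_nonneg (by norm_num) he.le
    linarith
  · intro t ht; simp only [cut_zero he ht, zero_mul]
  · intro t ht
    have h := tent_anti (abs_nonneg t) ht
    rw [tent_eq (by norm_num) (by norm_num), tent_abs] at h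
    simp only [cut_one he he1 ht]; linarith
  · intro s t hs hst ht
    have h1 := tent_trapezoid hst
    have habs : ∀ u, s ≤ u → u ≤ t → |u| ≤ 1 := fun u h1 h2 => abs_le.2 ⟨by linarith, by linarith⟩
    have h2 := mono_aux (f := fun u => 2 * prim (fun t => cut e t * tent t) u
        - cut e s * (2 * prim tent u) + ε * (1 - s ^ 2) * u) hst
      (fun u => (((prim_hasDerivAt hsm.continuous u).const_mul 2).sub
        (((prim_hasDerivAt tent_contDiff.continuous u).const_mul 2).const_mul (cut e s))).add
        ((hasDerivAt_id u).const_mul _))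
      (fun u h h' => by
        have := hcutdiff s u (habs s le_rfl hst) (habs u h h')
        simp only [mul_one]; linarith)
    have h3 : 0 ≤ cut e s * (2 * (prim tent t - prim tent s) - (t - s) * tent s) := by
      apply mul_nonneg (cut_nonneg _ _)
      have := mul_nonneg (sub_nonneg.2 hst) (tent_nonneg (habs t hst le_rfl))
      linarith
    beta_reduce at h2 ⊢
    linarith
  · intro s hs hs1
    have h2 := mono_aux (f := fun u => cut e s * (2 * u - u ^ 2) -
        2 * prim (fun t => cut e t * tent t) u) hs1
      (fun u => ((((hasDerivAt_id u).const_mul 2).sub (hasDerivAt_pow 2 u)).const_mul _).sub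
        ((prim_hasDerivAt hsm.continuous u).const_mul 2))
      (fun u h h' => by
        have h3 : cut e u ≤ cut e s := cut_anti he (by
          rw [abs_of_nonneg (by linarith), abs_of_nonneg (by linarith)]; exact h)
        have h4 : tent u = 1 - u := tent_eq (hs.trans h) h'
        rw [h4]
        have := mul_le_mul_of_nonneg_right h3 (sub_nonneg.2 h')
        norm_num
        linarith)
    have h4 : tent s = 1 - s := tent_eq hs hs1
    beta_reduce at h2 ⊢
    rw [h4]
    linarith

/-- `√(1+t²)` -/
def Rt (t : ℝ) : ℝ := Real.sqrt (1 + t ^ 2)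

lemma Rt_pos (t : ℝ) : 0 < Rt t := Real.sqrt_pos.2 (by positivity)

lemma Rt_sq (t : ℝ) : Rt t ^ 2 = 1 + t ^ 2 := Real.sq_sqrt (by positivity)

lemma Rt_neg (t : ℝ) : Rt (-t) = Rt t := by unfold Rt; simp

lemma sqrt2_pos : 0 < Real.sqrt 2 := by positivity

lemma sqrt2_sq : Real.sqrt 2 ^ 2 = 2 := Real.sq_sqrt (by norm_num)

lemma sqrt2_gt : 1.41 < Real.sqrt 2 := Real.lt_sqrt_of_sq_lt (by norm_num)

lemma sqrt2_lt : Real.sqrt 2 < 1.42 := (Real.sqrt_lt' (by norm_num)).2 (by norm_num)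

lemma Rt_one : Rt 1 = Real.sqrt 2 := by unfold Rt; norm_num

lemma Rt_hasDerivAt (t : ℝ) : HasDerivAt Rt (t / Rt t) t := by
  have h : HasDerivAt (fun t : ℝ => 1 + t ^ 2) (2 * t) t := by
    simpa using (hasDerivAt_pow 2 t).const_add 1
  have := h.sqrt (by positivity)
  refine this.congr_deriv ?_
  show 2 * t / (2 * √(1 + t ^ 2)) = t / √(1 + t ^ 2)
  rw [mul_div_mul_left _ _ two_ne_zero]

lemma Rt_contDiff : ContDiff ℝ (⊤ : ℕ∞) Rt := by
  unfold Rt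
  refine ContDiff.sqrt (by fun_prop) (fun x => by positivity)

def P1 (t : ℝ) : ℝ := t * (t ^ 2 + 3) / (Real.sqrt 2 * Rt t ^ 3)

def Ps (t : ℝ) : ℝ := (1 + 3 * t ^ 2) / (Real.sqrt 2 * Rt t ^ 3)

def kk (t : ℝ) : ℝ := 3 * (1 - t ^ 2) / (Real.sqrt 2 * Rt t ^ 5)

lemma P1_hasDerivAt (t : ℝ) : HasDerivAt P1 (kk t) t := by
  have hR := Rt_pos t
  have h2 := sqrt2_pos
  have h1 : HasDerivAt (fun t : ℝ => t * (t ^ 2 + 3)) (3 * t ^ 2 + 3) t := by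
    have := (hasDerivAt_id t).mul ((hasDerivAt_pow 2 t).add_const 3)
    refine this.congr_deriv ?_
    simp; ring
  have := h1.div (((Rt_hasDerivAt t).pow 3).const_mul (Real.sqrt 2)) (show √2 * Rt t ^ 3 ≠ 0 by positivity)
  refine this.congr_deriv ?_
  unfold kk
  have h3 := Rt_sq t
  simp only [Pi.pow_apply]
  push_cast
  field_simp
  rw [show Rt t ^ 2 = 1 + t ^ 2 from h3]
  ring

lemma Ps_hasDerivAt (t : ℝ) : HasDerivAt Ps (t * kk t) t := by
  have hR := Rt_pos t
  have h2 := sqrt2_pos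
  have h1 : HasDerivAt (fun t : ℝ => 1 + 3 * t ^ 2) (6 * t) t := by
    have := (((hasDerivAt_pow 2 t).const_mul 3).const_add 1)
    refine this.congr_deriv ?_
    simp; ring
  have := h1.div (((Rt_hasDerivAt t).pow 3).const_mul (Real.sqrt 2)) (show √2 * Rt t ^ 3 ≠ 0 by positivity)
  refine this.congr_deriv ?_
  unfold kk
  have h3 := Rt_sq t
  simp only [Pi.pow_apply]
  push_cast
  field_simp
  rw [show Rt t ^ 2 = 1 + t ^ 2 from h3]
  ring

lemma P1_neg (t : ℝ) : P1 (-t) = - P1 t := by unfold P1; rw [Rt_neg]; ring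

lemma Ps_neg (t : ℝ) : Ps (-t) = Ps t := by unfold Ps; rw [Rt_neg]; ring

lemma kk_neg (t : ℝ) : kk (-t) = kk t := by unfold kk; rw [Rt_neg]; ring

lemma sqrt2_cube : Real.sqrt 2 ^ 3 = 2 * Real.sqrt 2 := by
  have := sqrt2_sq
  rw [pow_succ, this]

lemma P1_one : P1 1 = 1 := by
  unfold P1; rw [Rt_one, sqrt2_cube]
  have := sqrt2_sq
  have h2 := sqrt2_pos
  rw [show √2 * (2 * √2) = 2 * √2 ^ 2 by ring, this]; norm_num

lemma Ps_one : Ps 1 = 1 := by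
  unfold Ps; rw [Rt_one, sqrt2_cube]
  have := sqrt2_sq
  rw [show √2 * (2 * √2) = 2 * √2 ^ 2 by ring, this]; norm_num

lemma P1_zero : P1 0 = 0 := by simp [P1]

lemma Ps_zero : Ps 0 = 1 / Real.sqrt 2 := by simp [Ps, Rt]

lemma kk_contDiff : ContDiff ℝ (⊤ : ℕ∞) kk := by
  unfold kk
  refine ContDiff.div (by fun_prop) (contDiff_const.mul (Rt_contDiff.pow 5)) (fun x => ?_)
  have := Rt_pos x; have := sqrt2_pos; positivity

lemma P1_contDiff : ContDiff ℝ (⊤ : ℕ∞) P1 := by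
  unfold P1
  refine ContDiff.div (by fun_prop) (contDiff_const.mul (Rt_contDiff.pow 3)) (fun x => ?_)
  have := Rt_pos x; have := sqrt2_pos; positivity

lemma Ps_contDiff : ContDiff ℝ (⊤ : ℕ∞) Ps := by
  unfold Ps
  refine ContDiff.div (by fun_prop) (contDiff_const.mul (Rt_contDiff.pow 3)) (fun x => ?_)
  have := Rt_pos x; have := sqrt2_pos; positivity

lemma sq_le_one_of {t : ℝ} (h1 : -1 ≤ t) (h2 : t ≤ 1) : 0 ≤ 1 - t ^ 2 := by nlinarith

lemma kk_nonneg {t : ℝ} (h1 : -1 ≤ t) (h2 : t ≤ 1) : 0 ≤ kk t := by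
  unfold kk
  have := Rt_pos t; have := sqrt2_pos; have := sq_le_one_of h1 h2
  positivity

lemma kk_ge {t : ℝ} (h1 : -1 ≤ t) (h2 : t ≤ 1) : 3 / 8 * (1 - t ^ 2) ≤ kk t := by
  unfold kk
  have hR := Rt_pos t; have h0 := sqrt2_pos; have h3 := sq_le_one_of h1 h2
  rw [le_div_iff₀ (by positivity)]
  have h4 : Rt t ≤ √2 := by
    unfold Rt; exact Real.sqrt_le_sqrt (by linarith)
  have h5 : √2 * Rt t ^ 5 ≤ √2 * √2 ^ 5 := by gcongr
  have h6 : √2 * √2 ^ 5 = 8 := by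
    rw [show √2 * √2 ^ 5 = (√2 ^ 2) ^ 3 by ring, sqrt2_sq]; norm_num
  nlinarith

lemma kk_ge_one {t : ℝ} (h : |t| ≤ 1 / 4) : 1 ≤ kk t := by
  unfold kk
  have hR := Rt_pos t; have h0 := sqrt2_pos
  have ht2 : t ^ 2 ≤ 1 / 16 := by rw [← sq_abs]; nlinarith [abs_nonneg t]
  rw [le_div_iff₀ (by positivity)]
  have h4 : Rt t ≤ 1.04 := by
    unfold Rt; rw [Real.sqrt_le_left (by norm_num)]; norm_num; linarith
  have h5 : √2 * Rt t ^ 5 ≤ 1.42 * 1.04 ^ 5 := by gcongr; exact sqrt2_lt.le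
  norm_num at h5
  linarith

lemma kk_le {t : ℝ} (h1 : -1 ≤ t) (h2 : t ≤ 1) : kk t ≤ 3 := by
  unfold kk
  have hR := Rt_pos t; have h0 := sqrt2_pos
  rw [div_le_iff₀ (by positivity)]
  have h4 : 1 ≤ Rt t := by
    unfold Rt; rw [Real.one_le_sqrt]; nlinarith
  have h5 : 1 ≤ √2 * Rt t ^ 5 := by
    have := one_le_pow₀ h4 (n := 5)
    have := sqrt2_gt
    nlinarith
  nlinarith

lemma P1_mono {s t : ℝ} (h1 : -1 ≤ s) (h : s ≤ t) (h2 : t ≤ 1) : P1 s ≤ P1 t :=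
  mono_aux h P1_hasDerivAt (fun _ _ _ => kk_nonneg (by linarith) (by linarith))

lemma P1_diff {s t : ℝ} (h1 : -1 ≤ s) (h : s ≤ t) (h2 : t ≤ 1) :
    (1 - s ^ 2) * (t - s) ≤ 8 * (P1 t - P1 s) := by
  have := mono_aux (f := fun u => P1 u - 3 / 8 * (u - u ^ 3 / 3)) h
    (fun u => (P1_hasDerivAt u).sub
      (((hasDerivAt_id u).sub ((hasDerivAt_pow 3 u).div_const 3)).const_mul (3 / 8)))
    (fun u h3 h4 => by
      have := kk_ge (t := u) (by linarith) (by linarith)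
      norm_num; linarith)
  have h5 : 0 ≤ (t - s) * (2 - t ^ 2 - t * s) := by
    apply mul_nonneg (by linarith); nlinarith
  nlinarith

lemma P1_lip {s t : ℝ} (h1 : -1 ≤ s) (h : s ≤ t) (h2 : t ≤ 1) : P1 t - P1 s ≤ 3 * (t - s) := by
  have := mono_aux (f := fun u => 3 * u - P1 u) h
    (fun u => ((hasDerivAt_id u).const_mul 3).sub (P1_hasDerivAt u))
    (fun u h3 h4 => by
      have := kk_le (t := u) (by linarith) (by linarith)
      norm_num; linarith)
  linarith

lemma Ps_diff {s t : ℝ} (h1 : -1 ≤ s) (h : s ≤ t) (h2 : t ≤ 1) :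
    |Ps t - Ps s| ≤ P1 t - P1 s := by
  have a := mono_aux (f := fun u => P1 u - Ps u) h
    (fun u => (P1_hasDerivAt u).sub (Ps_hasDerivAt u))
    (fun u h3 h4 => by
      have := kk_nonneg (t := u) (by linarith) (by linarith)
      nlinarith)
  have b := mono_aux (f := fun u => P1 u + Ps u) h
    (fun u => (P1_hasDerivAt u).add (Ps_hasDerivAt u))
    (fun u h3 h4 => by
      have := kk_nonneg (t := u) (by linarith) (by linarith)
      nlinarith)
  rw [abs_le]; constructor <;> linarith

def Ph (v : ℝ → ℝ) (t : ℝ) : ℝ := 2 * prim v t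

def FF (v : ℝ → ℝ) : ℝ → ℝ := prim (fun t => Ph v t * kk t)

def V1 (v : ℝ → ℝ) (t : ℝ) : ℝ := Ph v t - t * v t

def S2 (v : ℝ → ℝ) (s t : ℝ) : ℝ :=
  FF v t - FF v s - V1 v s * (P1 t - P1 s) - v s * (Ps t - Ps s)

def DD (v : ℝ → ℝ) (s q1 qs : ℝ) : ℝ :=
  FF v 1 + Ph v 1 * (q1 - 1) - FF v s - V1 v s * (q1 - P1 s) - v s * (qs - Ps s)

namespace VP

lemma Ph_hasDerivAt {ε η : ℝ} {v : ℝ → ℝ} (h : VP ε η v) (t : ℝ) : HasDerivAt (Ph v) (2 * v t) t :=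
  (prim_hasDerivAt h.smooth.continuous t).const_mul 2

lemma Ph_contDiff {ε η : ℝ} {v : ℝ → ℝ} (h : VP ε η v) : ContDiff ℝ (⊤ : ℕ∞) (Ph v) := contDiff_const.mul (prim_contDiff h.smooth)

lemma FF_contDiff {ε η : ℝ} {v : ℝ → ℝ} (h : VP ε η v) : ContDiff ℝ (⊤ : ℕ∞) (FF v) := prim_contDiff (h.Ph_contDiff.mul kk_contDiff)

lemma FF_hasDerivAt {ε η : ℝ} {v : ℝ → ℝ} (h : VP ε η v) (t : ℝ) : HasDerivAt (FF v) (Ph v t * kk t) t :=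
  prim_hasDerivAt (h.Ph_contDiff.mul kk_contDiff).continuous t

lemma Ph_neg {ε η : ℝ} {v : ℝ → ℝ} (h : VP ε η v) (t : ℝ) : Ph v (-t) = - Ph v t := by
  unfold Ph; rw [prim_odd h.even]; ring

lemma FF_neg {ε η : ℝ} {v : ℝ → ℝ} (h : VP ε η v) (t : ℝ) : FF v (-t) = FF v t := by
  unfold FF; rw [prim_even]; intro x; rw [h.Ph_neg, kk_neg]; ring

lemma V1_neg {ε η : ℝ} {v : ℝ → ℝ} (h : VP ε η v) (t : ℝ) : V1 v (-t) = - V1 v t := by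
  unfold V1; rw [h.Ph_neg, h.even]; ring

lemma S2_neg {ε η : ℝ} {v : ℝ → ℝ} (h : VP ε η v) (s t : ℝ) : S2 v (-s) (-t) = S2 v s t := by
  unfold S2; simp only [h.V1_neg, h.FF_neg, P1_neg, Ps_neg, h.even]; ring

lemma Ph_zero {ε η : ℝ} {v : ℝ → ℝ} (h : VP ε η v) : Ph v 0 = 0 := by unfold Ph; rw [prim_zero, mul_zero]

lemma Ph_mono {ε η : ℝ} {v : ℝ → ℝ} (h : VP ε η v) {s t : ℝ} (hst : s ≤ t) : Ph v s ≤ Ph v t :=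
  mono_aux hst h.Ph_hasDerivAt (fun u _ _ => by have := h.nonneg u; linarith)

lemma S2_hasDerivAt {ε η : ℝ} {v : ℝ → ℝ} (h : VP ε η v) (s t : ℝ) : HasDerivAt (S2 v s)
    ((Ph v t - Ph v s - (t - s) * v s) * kk t) t := by
  have := (((h.FF_hasDerivAt t).sub_const (FF v s)).sub
    (((P1_hasDerivAt t).sub_const (P1 s)).const_mul (V1 v s))).sub
    (((Ps_hasDerivAt t).sub_const (Ps s)).const_mul (v s))
  refine this.congr_deriv ?_
  unfold V1; ring

lemma S2_self {ε η : ℝ} {v : ℝ → ℝ} (h : VP ε η v) (s : ℝ) : S2 v s s = 0 := by unfold S2; ring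

lemma B' {ε η : ℝ} {v : ℝ → ℝ} (h : VP ε η v) {s t : ℝ} (h1 : -1 ≤ s) (h2 : s ≤ t) (h3 : t ≤ 1) :
    -ε * ((1 - s ^ 2) * (t - s)) ≤ Ph v t - Ph v s - (t - s) * v s := by
  have := h.B s t h1 h2 h3
  unfold Ph; linarith

lemma S2_ge_aux {ε η : ℝ} {v : ℝ → ℝ} (h : VP ε η v) (hε : 0 ≤ ε) {s t : ℝ} (h1 : -1 ≤ s) (h2 : s ≤ t) (h3 : t ≤ 1) :
    -(4 * ε) * (P1 t - P1 s) ^ 2 ≤ S2 v s t := by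
  have := mono_aux (f := fun u => S2 v s u + 4 * ε * (P1 u - P1 s) ^ 2) h2
    (fun u => (h.S2_hasDerivAt s u).add
      ((((P1_hasDerivAt u).sub_const (P1 s)).pow 2).const_mul (4 * ε)))
    (fun u h4 h5 => by
      have hk := kk_nonneg (t := u) (by linarith) (by linarith)
      have a := h.B' h1 h4 (by linarith)
      have b := mul_le_mul_of_nonneg_left (P1_diff h1 h4 (by linarith)) hε
      have c : 0 ≤ (Ph v u - Ph v s - (u - s) * v s) + 8 * ε * (P1 u - P1 s) := by linarith
      have := mul_nonneg c hk
      norm_num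
      linarith)
  rw [h.S2_self] at this
  linarith

lemma S2_ge {ε η : ℝ} {v : ℝ → ℝ} (h : VP ε η v) (hε : 0 ≤ ε) {s t : ℝ} (hs1 : -1 ≤ s) (hs : s ≤ 1) (ht1 : -1 ≤ t) (ht : t ≤ 1) :
    -(4 * ε) * (P1 t - P1 s) ^ 2 ≤ S2 v s t := by
  rcases le_total s t with hst | hst
  · exact h.S2_ge_aux hε hs1 hst ht
  · have := h.S2_ge_aux hε (s := -s) (t := -t) (by linarith) (by linarith) (by linarith)
    rw [h.S2_neg, P1_neg, P1_neg] at this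
    linarith

lemma DD_one {ε η : ℝ} {v : ℝ → ℝ} (h : VP ε η v) (s : ℝ) : DD v s 1 1 = S2 v s 1 := by
  unfold DD S2; rw [P1_one, Ps_one]; ring

lemma DD_eq {ε η : ℝ} {v : ℝ → ℝ} (h : VP ε η v) (s q1 qs : ℝ) : DD v s q1 qs = S2 v s 1
    - (Ph v 1 - Ph v s - (1 - s) * v s) * (1 - q1) + v s * (q1 - qs) := by
  rw [← h.DD_one]; unfold DD V1; ring

lemma DD_ge_of_ge {ε η : ℝ} {v : ℝ → ℝ} (h : VP ε η v) {s q1 qs : ℝ} (hs : 1 / 200 ≤ s) (hs1 : s ≤ 1) (hq : q1 ≤ 1) (hqs : qs ≤ q1) :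
    S2 v s 1 ≤ DD v s q1 qs := by
  rw [h.DD_eq]
  have h1 := h.conc s hs hs1
  have h2 : Ph v 1 - Ph v s - (1 - s) * v s ≤ 0 := by unfold Ph; linarith
  have := mul_nonneg (h.nonneg s) (sub_nonneg.2 hqs)
  have := mul_nonneg (neg_nonneg.2 h2) (sub_nonneg.2 hq)
  linarith

lemma DD_ge_near {ε η : ℝ} {v : ℝ → ℝ} (h : VP ε η v) {s q1 qs : ℝ} (hs : 1 / 200 ≤ s) (hs1 : s ≤ 1) (hq : q1 ≤ 1) :
    v s * ((Ps s - P1 s) + (q1 - qs) - (1 - s) * (1 - P1 s)) ≤ DD v s q1 qs := by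
  have h0 := mono_aux (f := fun u => FF v u - Ph v s * P1 u) hs1
    (fun u => (h.FF_hasDerivAt u).sub ((P1_hasDerivAt u).const_mul _))
    (fun u h4 h5 => by
      have := h.Ph_mono h4
      have hk := kk_nonneg (t := u) (by linarith) (by linarith)
      nlinarith)
  rw [P1_one] at h0
  have h1 := h.conc s hs hs1
  have h2 : Ph v 1 - Ph v s ≤ (1 - s) * v s := by unfold Ph; linarith
  have h3 := mul_le_mul_of_nonneg_right h2 (sub_nonneg.2 hq)
  unfold DD V1
  linarith

lemma Ph_le {ε η : ℝ} {v : ℝ → ℝ} (h : VP ε η v) {t : ℝ} (ht : 0 ≤ t) : Ph v t ≤ 2 * t := by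
  have := mono_aux (f := fun u => 2 * u - Ph v u) ht
    (fun u => ((hasDerivAt_id u).const_mul 2).sub (h.Ph_hasDerivAt u))
    (fun u h4 h5 => by have := h.le_one u; linarith)
  rw [h.Ph_zero] at this; linarith

lemma Ph_one_le {ε η : ℝ} {v : ℝ → ℝ} (h : VP ε η v) : Ph v 1 ≤ 1 + 1 / 200 := by
  have h1 := h.conc (1 / 200) le_rfl (by norm_num)
  have h2 := h.Ph_le (t := 1 / 200) (by norm_num)
  have h3 := h.le_one (1 / 200)
  unfold Ph at *
  linarith

lemma Ph_one_nonneg {ε η : ℝ} {v : ℝ → ℝ} (h : VP ε η v) : 0 ≤ Ph v 1 := by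
  have := h.Ph_mono (zero_le_one (α := ℝ)); rwa [h.Ph_zero] at this

lemma Ph_ge {ε η : ℝ} {v : ℝ → ℝ} (h : VP ε η v) {t : ℝ} (ht : 0 ≤ t) (ht1 : t ≤ 1 / 4) : 3 / 2 * t ≤ Ph v t := by
  have := mono_aux (f := fun u => Ph v u - 3 / 2 * u) ht
    (fun u => (h.Ph_hasDerivAt u).sub ((hasDerivAt_id u).const_mul (3 / 2)))
    (fun u h4 h5 => by
      have := h.ge u (by rw [abs_of_nonneg h4]; linarith)
      linarith)
  rw [h.Ph_zero] at this; linarith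

/-- concavity of `Ph` on `[0,1]`. -/
lemma Ph_star {ε η : ℝ} {v : ℝ → ℝ} (h : VP ε η v) {t : ℝ} (ht : 0 ≤ t) (ht1 : t ≤ 1) : t * Ph v 1 ≤ Ph v t := by
  have a := mono_aux (f := fun u => Ph v u - 2 * v t * u) ht
    (fun u => (h.Ph_hasDerivAt u).sub ((hasDerivAt_id u).const_mul (2 * v t)))
    (fun u h4 h5 => by
      have := h.anti u t (by rw [abs_of_nonneg h4, abs_of_nonneg ht]; exact h5)
      linarith)
  have b := mono_aux (f := fun u => 2 * v t * u - Ph v u) ht1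
    (fun u => ((hasDerivAt_id u).const_mul (2 * v t)).sub (h.Ph_hasDerivAt u))
    (fun u h4 h5 => by
      have := h.anti t u (by rw [abs_of_nonneg ht, abs_of_nonneg (ht.trans h4)]; exact h4)
      linarith)
  rw [h.Ph_zero] at a
  nlinarith

lemma K_ge {ε η : ℝ} {v : ℝ → ℝ} (h : VP ε η v) : 0.015 + FF v 0 + Ph v 1 * (1 - 1 / √2) ≤ FF v 1 := by
  have a := mono_aux (f := fun u => FF v u - Ph v 1 * Ps u) (show (1 / 4 : ℝ) ≤ 1 by norm_num)
    (fun u => (h.FF_hasDerivAt u).sub ((Ps_hasDerivAt u).const_mul _))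
    (fun u h4 h5 => by
      have := h.Ph_star (t := u) (by linarith) h5
      have hk := kk_nonneg (t := u) (by linarith) (by linarith)
      nlinarith)
  have b := mono_aux (f := fun u => FF v u - Ph v 1 * Ps u - 0.495 / 2 * u ^ 2)
    (show (0 : ℝ) ≤ 1 / 4 by norm_num)
    (fun u => ((h.FF_hasDerivAt u).sub ((Ps_hasDerivAt u).const_mul _)).sub
      ((hasDerivAt_pow 2 u).const_mul _))
    (fun u h4 h5 => by
      have h6 := h.Ph_ge h4 h5
      have hk := kk_ge_one (t := u) (by rw [abs_of_nonneg h4]; exact h5)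
      have h7 := h.Ph_one_le
      have h8 : 0.495 * u ≤ Ph v u - Ph v 1 * u := by nlinarith
      have h9 : 0.495 * u ≤ (Ph v u - Ph v 1 * u) * kk u := by nlinarith
      norm_num at h9 ⊢
      linarith)
  rw [Ps_one] at a
  rw [Ps_zero] at b
  norm_num at a b ⊢
  linarith

lemma S2_zero_nonneg {ε η : ℝ} {v : ℝ → ℝ} (h : VP ε η v) {s : ℝ} (h1 : -1 ≤ s) (h2 : s ≤ 1) : 0 ≤ S2 v s 0 := by
  have key : ∀ s, -1 ≤ s → s ≤ 0 → 0 ≤ S2 v s 0 := by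
    intro s h1 h2
    have := mono_aux h2 (h.S2_hasDerivAt s) (fun u h3 h4 => by
      have hk := kk_nonneg (t := u) (by linarith) (by linarith)
      apply mul_nonneg _ hk
      have := mono_aux (f := fun x => Ph v x - x * v s) h3
        (fun x => (h.Ph_hasDerivAt x).sub ((hasDerivAt_id x).mul_const _))
        (fun x h5 h6 => by
          have := h.anti x s (by rw [abs_of_nonpos (by linarith), abs_of_nonpos h2]; linarith)
          have := h.nonneg x
          linarith)
      linarith)
    rwa [h.S2_self] at this
  rcases le_total s 0 with hs | hs
  · exact key s h1 hs
  · have := key (-s) (by linarith) (by linarith)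
    have h4 := h.S2_neg s 0
    rw [neg_zero] at h4
    linarith

lemma V1_le {ε η : ℝ} {v : ℝ → ℝ} (h : VP ε η v) {s : ℝ} (h2 : s ≤ 1 / 200) : V1 v s ≤ 1 / 100 := by
  rcases le_total 0 s with hs | hs
  · have := h.Ph_le hs
    have := mul_nonneg hs (h.nonneg s)
    unfold V1; linarith
  · have a := mono_aux (f := fun u => Ph v u - v s * u) hs
      (fun u => (h.Ph_hasDerivAt u).sub ((hasDerivAt_id u).const_mul (v s)))
      (fun u h4 h5 => by
        have := h.anti u s (by rw [abs_of_nonpos h5, abs_of_nonpos hs]; linarith)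
        have := h.nonneg u
        linarith)
    rw [h.Ph_zero] at a
    unfold V1; linarith

lemma DD_e {ε η : ℝ} {v : ℝ → ℝ} (h : VP ε η v) {s : ℝ} (h1 : -1 ≤ s) (h2 : s ≤ 1 / 200) :
    1 / 200 ≤ DD v s (1 / √2) (1 / √2) := by
  have a := h.K_ge
  have b := h.S2_zero_nonneg h1 (by linarith)
  have c := h.V1_le h2
  unfold S2 at b
  rw [P1_zero, Ps_zero] at b
  unfold DD
  have hs := sqrt2_gt
  have d : 1 / √2 ≤ 0.72 := by
    rw [div_le_iff₀ sqrt2_pos]; nlinarith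
  have d0 : 0 < 1 / √2 := by positivity
  have e : V1 v s * (1 / √2) ≤ 0.0072 := by
    nlinarith
  norm_num at a b e ⊢
  linarith

lemma DD_ge_min {ε η : ℝ} {v : ℝ → ℝ} (h : VP ε η v) {s q1 qs : ℝ} (h1 : -1 ≤ s) (h2 : s ≤ 1 / 200) (hq1 : q1 ≤ 1)
    (hq0 : 1 / √2 ≤ q1) (hqs : qs ≤ q1) : min (S2 v s 1) (1 / 200) ≤ DD v s q1 qs := by
  have a := h.DD_e h1 h2
  rw [h.DD_eq] at a ⊢
  have b := mul_nonneg (h.nonneg s) (sub_nonneg.2 hqs)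
  set N := Ph v 1 - Ph v s - (1 - s) * v s
  rcases le_total N 0 with hN | hN
  · have := mul_nonneg (neg_nonneg.2 hN) (sub_nonneg.2 hq1)
    have := min_le_left (S2 v s 1) (1 / 200)
    linarith
  · have := min_le_right (S2 v s 1) (1 / 200)
    have := mul_nonneg hN (sub_nonneg.2 hq0)
    nlinarith

lemma S2_strict_aux {ε η : ℝ} {v : ℝ → ℝ} (h : VP ε η v) (hε : 0 ≤ ε) (hε1 : ε ≤ 1 / 1000) {s t : ℝ} (h1 : |s| ≤ 1 / 200) (h2 : s ≤ t)
    (h3 : t ≤ 1) :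
    1 / 400 * (P1 t - P1 s) ^ 2 ≤ S2 v s t ∧ (t = 1 → 1 / 200 ≤ S2 v s t) := by
  obtain ⟨hs1, hs2⟩ := abs_le.1 h1
  have key : ∀ t, s ≤ t → t ≤ 1 / 4 → 1 / 4 * (t - s) ^ 2 ≤ S2 v s t := by
    intro t h2 h3
    have := mono_aux (f := fun u => S2 v s u - 1 / 4 * (u - s) ^ 2) h2
      (fun u => (h.S2_hasDerivAt s u).sub
        ((((hasDerivAt_id u).sub_const s).pow 2).const_mul (1 / 4)))
      (fun u h4 h5 => by
        have hk := kk_ge_one (t := u) (abs_le.2 ⟨by linarith, by linarith⟩)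
        have h6 : 1 / 2 * (u - s) ≤ Ph v u - Ph v s - (u - s) * v s := by
          have := mono_aux (f := fun x => Ph v x - 3 / 2 * x) h4
            (fun x => (h.Ph_hasDerivAt x).sub ((hasDerivAt_id x).const_mul (3 / 2)))
            (fun x h7 h8 => by
              have := h.ge x (abs_le.2 ⟨by linarith, by linarith⟩)
              linarith)
          have h9 := h.le_one s
          nlinarith
        have h7 : 1 / 2 * (u - s) ≤ (Ph v u - Ph v s - (u - s) * v s) * kk u := by
          nlinarith
        norm_num at h7 ⊢
        linarith)
    rw [h.S2_self] at this
    linarith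
  have hP := P1_lip (by linarith) h2 h3
  have hP0 := P1_mono (by linarith) h2 h3
  rcases le_total t (1 / 4) with ht | ht
  · have := key t h2 ht
    refine ⟨?_, fun h => by linarith⟩
    have : (P1 t - P1 s) ^ 2 ≤ (3 * (t - s)) ^ 2 := by
      apply pow_le_pow_left₀ (by linarith) hP
    nlinarith [sq_nonneg (t - s)]
  · have k4 := key (1 / 4) (by linarith) le_rfl
    have k5 : (0.01475 : ℝ) ≤ 1 / 4 * (1 / 4 - s) ^ 2 := by nlinarith
    have := mono_aux (f := fun u => S2 v s u + 2 * ε * P1 u) ht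
      (fun u => (h.S2_hasDerivAt s u).add ((P1_hasDerivAt u).const_mul _))
      (fun u h4 h5 => by
        have hk := kk_nonneg (t := u) (by linarith) (by linarith)
        have a := h.B' (s := s) (t := u) (by linarith) (by linarith) (by linarith)
        have b : (1 - s ^ 2) * (u - s) ≤ 2 := by nlinarith
        have c : 0 ≤ Ph v u - Ph v s - (u - s) * v s + 2 * ε := by nlinarith
        have := mul_nonneg c hk
        linarith)
    have p1 : P1 t ≤ 1 := by
      have := P1_mono (s := t) (t := 1) (by linarith) h3 le_rfl
      rwa [P1_one] at this
    have p2 : 0 ≤ P1 (1 / 4) := by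
      have := P1_mono (s := 0) (t := 1 / 4) (by norm_num) (by norm_num) (by norm_num)
      rwa [P1_zero] at this
    have p3 : -1 ≤ P1 s := by
      have := P1_mono (s := -1) (t := s) le_rfl (by linarith) (by linarith)
      rwa [P1_neg, P1_one] at this
    have h10 : 0.01 ≤ S2 v s t := by nlinarith
    refine ⟨?_, fun _ => by norm_num at h10 ⊢; linarith⟩
    have : (P1 t - P1 s) ^ 2 ≤ 4 := by nlinarith
    norm_num at h10 ⊢; linarith

lemma S2_strict {ε η : ℝ} {v : ℝ → ℝ} (h : VP ε η v) (hε : 0 ≤ ε) (hε1 : ε ≤ 1 / 1000) {s t : ℝ} (h1 : |s| ≤ 1 / 200) (h2 : -1 ≤ t)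
    (h3 : t ≤ 1) : 1 / 400 * (P1 t - P1 s) ^ 2 ≤ S2 v s t := by
  rcases le_total s t with hst | hst
  · exact (h.S2_strict_aux hε hε1 h1 hst h3).1
  · have := (h.S2_strict_aux hε hε1 (s := -s) (t := -t) (by rwa [abs_neg]) (by linarith)
      (by linarith)).1
    rw [h.S2_neg, P1_neg, P1_neg] at this
    linarith

lemma DD_strict {ε η : ℝ} {v : ℝ → ℝ} (h : VP ε η v) (hε : 0 ≤ ε) (hε1 : ε ≤ 1 / 1000) {s q1 qs : ℝ} (h1 : |s| ≤ 1 / 200)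
    (hq1 : q1 ≤ 1) (hq0 : 1 / √2 ≤ q1) (hqs : qs ≤ q1) : 1 / 200 ≤ DD v s q1 qs := by
  obtain ⟨hs1, hs2⟩ := abs_le.1 h1
  have a := (h.S2_strict_aux hε hε1 h1 (show s ≤ 1 by linarith) le_rfl).2 rfl
  have b := h.DD_ge_min (by linarith) hs2 hq1 hq0 hqs
  rwa [min_eq_right a] at b

lemma L_R {ε η : ℝ} {v : ℝ → ℝ} (h : VP ε η v) {t : ℝ} (h2 : -1 ≤ t) (h3 : t ≤ 1) : Ph v 1 * (P1 t - 1) ≤ FF v t - FF v 1 := by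
  have := mono_aux (f := fun u => Ph v 1 * P1 u - FF v u) h3
    (fun u => ((P1_hasDerivAt u).const_mul _).sub (h.FF_hasDerivAt u))
    (fun u h4 h5 => by
      have := h.Ph_mono h5
      have hk := kk_nonneg (t := u) (by linarith) (by linarith)
      nlinarith)
  rw [P1_one] at this
  linarith

/-- crude lower bound for `DD`. -/
lemma DD_ge {ε η : ℝ} {v : ℝ → ℝ} (h : VP ε η v) (hε : 0 ≤ ε) {s q1 qs : ℝ} (h1 : -1 ≤ s) (h2 : s ≤ 1)
    (hq1 : q1 ≤ 1) (hq0 : 1 / √2 ≤ q1) (hqs : qs ≤ q1) :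
    -(4 * ε) * (1 - P1 s) ^ 2 ≤ DD v s q1 qs := by
  have a := h.S2_ge hε h1 h2 (show (-1 : ℝ) ≤ 1 by norm_num) le_rfl
  rw [P1_one] at a
  rcases le_total s (1 / 200) with hs | hs
  · refine le_trans (le_min a ?_) (h.DD_ge_min h1 hs hq1 hq0 hqs)
    nlinarith [mul_nonneg hε (sq_nonneg (1 - P1 s))]
  · exact a.trans (h.DD_ge_of_ge hs h2 hq1 hqs)

end VP

abbrev E3 := EuclideanSpace ℝ (Fin 3)

def pr (i : Fin 3) : E3 →L[ℝ] ℝ := EuclideanSpace.proj i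

lemma pr_apply (i : Fin 3) (y : E3) : pr i y = y i := rfl

lemma coord_hasFDerivAt (i : Fin 3) (x : E3) : HasFDerivAt (fun x : E3 => x i) (pr i) x :=
  (pr i).hasFDerivAt

lemma coord_contDiff (i : Fin 3) : ContDiff ℝ (⊤ : ℕ∞) (fun x : E3 => x i) := (pr i).contDiff

lemma coord_cont (i : Fin 3) : Continuous (fun x : E3 => x i) := (pr i).continuous

lemma inner3 (x y : E3) : ⟪x, y⟫ = x 0 * y 0 + x 1 * y 1 + x 2 * y 2 := by
  rw [PiLp.inner_apply, Fin.sum_univ_three]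
  simp [mul_comm]

lemma norm3 (x : E3) : ‖x‖ = √((x 0) ^ 2 + ((x 1) ^ 2 + (x 2) ^ 2)) := by
  rw [EuclideanSpace.norm_eq, Fin.sum_univ_three]
  simp [add_assoc]

lemma norm3_sq (x : E3) : ‖x‖ ^ 2 = (x 0) ^ 2 + ((x 1) ^ 2 + (x 2) ^ 2) := by
  rw [norm3, Real.sq_sqrt (by positivity)]

lemma grad_of {f : E3 → ℝ} {x : E3} {L : E3 →L[ℝ] ℝ} (h : HasFDerivAt f L x) (w : E3)
    (hw : ∀ y, L y = w 0 * y 0 + w 1 * y 1 + w 2 * y 2) : HasGradientAt f w x := by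
  have : L = InnerProductSpace.toDual ℝ E3 w := by
    ext y
    rw [hw, InnerProductSpace.toDual_apply_apply, inner3]
  rw [this] at h
  exact h

def rr (x : E3) : ℝ := √((x 1) ^ 2 + (x 2) ^ 2)

lemma rr_nonneg (x : E3) : 0 ≤ rr x := Real.sqrt_nonneg _

lemma rr_sq (x : E3) : rr x ^ 2 = (x 1) ^ 2 + (x 2) ^ 2 := Real.sq_sqrt (by positivity)

lemma rr_cont : Continuous rr :=
  (((coord_cont 1).pow 2).add ((coord_cont 2).pow 2)).sqrt

lemma norm_rr (x : E3) : ‖x‖ ^ 2 = (x 0) ^ 2 + rr x ^ 2 := by rw [norm3_sq, rr_sq]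

lemma rr_hasFDerivAt {x : E3} (hx : 0 < rr x) :
    HasFDerivAt rr ((x 1 / rr x) • pr 1 + (x 2 / rr x) • pr 2) x := by
  have h1 := ((coord_hasFDerivAt 1 x).pow 2).add ((coord_hasFDerivAt 2 x).pow 2)
  have h2 := h1.sqrt (x := x) (by
    show (x 1) ^ 2 + (x 2) ^ 2 ≠ 0
    rw [← rr_sq]; positivity)
  refine h2.congr_fderiv ?_
  ext y
  show (1 / (2 * rr x)) * _ = _
  simp [pr_apply]
  field_simp

lemma rr_contDiffAt {x : E3} (hx : 0 < rr x) : ContDiffAt ℝ (⊤ : ℕ∞) rr x := by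
  have h1 := ((coord_contDiff 1).pow 2).add ((coord_contDiff 2).pow 2)
  exact h1.contDiffAt.sqrt (by
    show (x 1) ^ 2 + (x 2) ^ 2 ≠ 0
    rw [← rr_sq]; positivity)

/-- the gradient of `u0` away from zero -/
def gu (x : E3) : E3 :=
  !₂[-(x 0) * (3 * ((x 1) ^ 2 + (x 2) ^ 2) + (x 0) ^ 2) / (√2 * ‖x‖ ^ 3),
    x 1 * (((x 1) ^ 2 + (x 2) ^ 2) + 3 * (x 0) ^ 2) / (√2 * ‖x‖ ^ 3),
    x 2 * (((x 1) ^ 2 + (x 2) ^ 2) + 3 * (x 0) ^ 2) / (√2 * ‖x‖ ^ 3)]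

lemma norm_hasFDerivAt' {x : E3} (hx : x ≠ 0) :
    HasFDerivAt (fun x : E3 => ‖x‖) ((x 0 / ‖x‖) • pr 0 + (x 1 / ‖x‖) • pr 1 + (x 2 / ‖x‖) • pr 2)
      x := by
  have hn : 0 < ‖x‖ := norm_pos_iff.2 hx
  have h1 := ((coord_hasFDerivAt 0 x).pow 2).add
    (((coord_hasFDerivAt 1 x).pow 2).add ((coord_hasFDerivAt 2 x).pow 2))
  have h2 := h1.sqrt (x := x) (by
    show (x 0) ^ 2 + ((x 1) ^ 2 + (x 2) ^ 2) ≠ 0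
    rw [← norm3_sq]; positivity)
  rw [show (fun x : E3 => ‖x‖) = _ from funext norm3]
  refine h2.congr_fderiv ?_
  ext y
  show (1 / (2 * √((x 0) ^ 2 + ((x 1) ^ 2 + (x 2) ^ 2)))) * _ = _
  rw [← norm3]
  simp [pr_apply]
  field_simp
  ring

lemma fdiv {f g : E3 → ℝ} {f' g' : E3 →L[ℝ] ℝ} {x : E3} (hf : HasFDerivAt f f' x)
    (hg : HasFDerivAt g g' x) (h0 : g x ≠ 0) :
    HasFDerivAt (fun y => f y / g y) ((1 / g x) • f' - (f x / g x ^ 2) • g') x := by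
  have := hf.mul ((hasDerivAt_inv h0).comp_hasFDerivAt x hg)
  simp only [div_eq_mul_inv]
  refine this.congr_fderiv ?_
  ext y
  simp
  field_simp
  ring

lemma u0_hasGradientAt {x : E3} (hx : x ≠ 0) : HasGradientAt u0 (gu x) x := by
  have hn : 0 < ‖x‖ := norm_pos_iff.2 hx
  have h2 := sqrt2_pos
  have h1 := fdiv ((((coord_hasFDerivAt 1 x).pow 2).add ((coord_hasFDerivAt 2 x).pow 2)).sub
    ((coord_hasFDerivAt 0 x).pow 2)) ((norm_hasFDerivAt' hx).const_mul (√2))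
    (show √2 * ‖x‖ ≠ 0 by positivity)
  refine grad_of h1 _ (fun y => ?_)
  simp [pr_apply, gu]
  have h3 := norm3_sq x
  have h4 : x 0 ^ 2 = ‖x‖ ^ 2 - (x 1 ^ 2 + x 2 ^ 2) := by linarith
  field_simp
  rw [h3]
  ring

lemma gradient_u0 {x : E3} (hx : x ≠ 0) : gradient u0 x = gu x := (u0_hasGradientAt hx).gradient

lemma gu_contDiffAt {x : E3} (hx : x ≠ 0) : ContDiffAt ℝ (⊤ : ℕ∞) gu x := by
  have hn : 0 < ‖x‖ := norm_pos_iff.2 hx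
  have h2 := sqrt2_pos
  have hN : ContDiffAt ℝ (⊤ : ℕ∞) (fun x : E3 => √2 * ‖x‖ ^ 3) x :=
    contDiffAt_const.mul ((contDiffAt_norm ℝ hx).pow 3)
  have c := fun i => (coord_contDiff i).contDiffAt (x := x)
  have c12 := ((c 1).pow 2).add ((c 2).pow 2)
  have h0 : √2 * ‖x‖ ^ 3 ≠ 0 := by positivity
  rw [contDiffAt_euclidean]
  intro i
  fin_cases i
  · exact (((c 0).neg).mul ((contDiffAt_const (c := (3:ℝ)).mul c12).add ((c 0).pow 2))).div hN h0
  · exact ((c 1).mul (c12.add (contDiffAt_const (c := (3:ℝ)).mul ((c 0).pow 2)))).div hN h0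
  · exact ((c 2).mul (c12.add (contDiffAt_const (c := (3:ℝ)).mul ((c 0).pow 2)))).div hN h0

lemma gu0 (x : E3) : gu x 0 = -(x 0) * (3 * rr x ^ 2 + (x 0) ^ 2) / (√2 * ‖x‖ ^ 3) := by
  rw [rr_sq]; rfl
lemma gu1 (x : E3) : gu x 1 = x 1 * (rr x ^ 2 + 3 * (x 0) ^ 2) / (√2 * ‖x‖ ^ 3) := by
  rw [rr_sq]; rfl
lemma gu2 (x : E3) : gu x 2 = x 2 * (rr x ^ 2 + 3 * (x 0) ^ 2) / (√2 * ‖x‖ ^ 3) := by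
  rw [rr_sq]; rfl
lemma rr_gu (x : E3) : rr (gu x) = rr x * (rr x ^ 2 + 3 * (x 0) ^ 2) / (√2 * ‖x‖ ^ 3) := by
  have h := rr_nonneg x
  have h2 := sqrt2_pos
  have : 0 ≤ rr x * (rr x ^ 2 + 3 * (x 0) ^ 2) / (√2 * ‖x‖ ^ 3) := by positivity
  rw [show rr (gu x) = √((gu x 1) ^ 2 + (gu x 2) ^ 2) from rfl, ← Real.sqrt_sq this]
  congr 1
  rw [gu1, gu2]
  simp only [div_pow, mul_pow]
  nth_rewrite 3 [rr_sq]
  ring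

lemma gu_sub (x : E3) : rr (gu x) - gu x 0 = (rr x + x 0) ^ 3 / (√2 * ‖x‖ ^ 3) := by
  rw [rr_gu, gu0]; ring
lemma gu_add (x : E3) : rr (gu x) + gu x 0 = (rr x - x 0) ^ 3 / (√2 * ‖x‖ ^ 3) := by
  rw [rr_gu, gu0]; ring

lemma gu_ne_zero {x : E3} (hx : x ≠ 0) : gu x ≠ 0 := by
  intro h
  have hn : 0 < ‖x‖ := norm_pos_iff.2 hx
  have h2 := sqrt2_pos
  have h0 : √2 * ‖x‖ ^ 3 ≠ 0 := by positivity
  have a := gu_sub x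
  have b := gu_add x
  have h1 : rr (0 : E3) = 0 := by simp [rr]
  rw [h, h1, eq_div_iff h0] at a b
  simp only [zero_mul, PiLp.zero_apply, sub_zero, add_zero] at a b
  have a := pow_eq_zero_iff (n := 3) (by norm_num) |>.1 a.symm
  have b := pow_eq_zero_iff (n := 3) (by norm_num) |>.1 b.symm
  have c : x 0 = 0 := by linarith
  have d : rr x = 0 := by linarith
  have e := norm_rr x
  rw [c, d] at e
  simp at e
  exact hx e

/-- the parameter of the point of the profile curve associated with `(a, b)`. -/
def TT (a b : ℝ) : ℝ :=
  (a ^ (1 / 3 : ℝ) - b ^ (1 / 3 : ℝ)) / (a ^ (1 / 3 : ℝ) + b ^ (1 / 3 : ℝ))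

lemma TT_swap (a b : ℝ) : TT b a = - TT a b := by
  unfold TT; rw [← neg_div, add_comm]; congr 1; ring

lemma cbrt_cube {x : ℝ} (hx : 0 ≤ x) : (x ^ 3) ^ (1 / 3 : ℝ) = x := by
  have := Real.pow_rpow_inv_natCast hx (n := 3) (by norm_num)
  rw [one_div]; exact_mod_cast this

lemma TT_ge {η a b : ℝ} (hη : 0 < η) (ha : 0 < a) (hb : 0 < b)
    (h : b < (η / 2) ^ 3 * a) : 1 - η ≤ TT a b ∧ TT a b ≤ 1 := by
  have h1 : b ^ (1 / 3 : ℝ) ≤ ((η / 2) ^ 3 * a) ^ (1 / 3 : ℝ) :=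
    Real.rpow_le_rpow hb.le h.le (by norm_num)
  rw [Real.mul_rpow (by positivity) ha.le, cbrt_cube (by positivity)] at h1
  have h2 : 0 < a ^ (1 / 3 : ℝ) := Real.rpow_pos_of_pos ha _
  have h3 : 0 < b ^ (1 / 3 : ℝ) := Real.rpow_pos_of_pos hb _
  unfold TT
  constructor
  · rw [le_div_iff₀ (by positivity)]
    nlinarith
  · rw [div_le_one (by positivity)]
    linarith

lemma TT_cube {α β m : ℝ} (ha : 0 < α) (hb : 0 < β) (hm : 0 < m) :
    TT (α ^ 3 / m) (β ^ 3 / m) = (α - β) / (α + β) := by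
  unfold TT
  rw [Real.div_rpow (by positivity) hm.le, Real.div_rpow (by positivity) hm.le,
    cbrt_cube ha.le, cbrt_cube hb.le]
  have := Real.rpow_pos_of_pos hm (1 / 3)
  field_simp

def HH (v : ℝ → ℝ) (t q1 qs : ℝ) : ℝ :=
  FF v t + V1 v t * (q1 - P1 t) + v t * (qs - Ps t)

def tp (p : E3) : ℝ := TT (rr p + p 0) (rr p - p 0)

def GG (v : ℝ → ℝ) (p : E3) : ℝ :=
  if |p 0| < rr p then HH v (tp p) (p 0) (rr p)
  else Ph v 1 * |p 0| + (FF v 1 - Ph v 1)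

lemma tp_contDiffAt {p : E3} (hp : |p 0| < rr p) : ContDiffAt ℝ (⊤ : ℕ∞) tp p := by
  obtain ⟨h1, h2⟩ := abs_lt.1 hp
  have h0 : 0 < rr p := (abs_nonneg _).trans_lt hp
  have a : 0 < rr p + p 0 := by linarith
  have b : 0 < rr p - p 0 := by linarith
  have ca : ContDiffAt ℝ (⊤ : ℕ∞) (fun p : E3 => (rr p + p 0) ^ (1 / 3 : ℝ)) p :=
    ((rr_contDiffAt h0).add (coord_contDiff 0).contDiffAt).rpow_const_of_ne a.ne'
  have cb : ContDiffAt ℝ (⊤ : ℕ∞) (fun p : E3 => (rr p - p 0) ^ (1 / 3 : ℝ)) p :=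
    ((rr_contDiffAt h0).sub (coord_contDiff 0).contDiffAt).rpow_const_of_ne b.ne'
  have h2 : 0 < (rr p + p 0) ^ (1 / 3 : ℝ) := Real.rpow_pos_of_pos a _
  have h3 : 0 < (rr p - p 0) ^ (1 / 3 : ℝ) := Real.rpow_pos_of_pos b _
  exact (ca.sub cb).div (ca.add cb) (by positivity)

lemma W0_open : IsOpen {p : E3 | |p 0| < rr p} :=
  isOpen_lt ((coord_cont 0).abs) rr_cont

lemma GG_W0 (v : ℝ → ℝ) {p : E3} (hp : |p 0| < rr p) :
    GG v =ᶠ[nhds p] fun p => HH v (tp p) (p 0) (rr p) := by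
  filter_upwards [W0_open.mem_nhds hp] with q hq
  exact if_pos hq

namespace VP

lemma V1_contDiff {ε η : ℝ} {v : ℝ → ℝ} (h : VP ε η v) : ContDiff ℝ (⊤ : ℕ∞) (V1 v) :=
  h.Ph_contDiff.sub (contDiff_id.mul h.smooth)

lemma GG_contDiffAt_W0 {ε η : ℝ} {v : ℝ → ℝ} (h : VP ε η v) {p : E3} (hp : |p 0| < rr p) :
    ContDiffAt ℝ (⊤ : ℕ∞) (GG v) p := by
  have h0 : 0 < rr p := (abs_nonneg _).trans_lt hp
  refine ContDiffAt.congr_of_eventuallyEq ?_ (GG_W0 v hp)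
  have ht := tp_contDiffAt hp
  have c : ∀ {f : ℝ → ℝ}, ContDiff ℝ (⊤ : ℕ∞) f → ContDiffAt ℝ (⊤ : ℕ∞) (fun p => f (tp p)) p :=
    fun hf => hf.contDiffAt.comp p ht
  exact ((c h.FF_contDiff).add ((c h.V1_contDiff).mul
    ((coord_contDiff 0).contDiffAt.sub (c P1_contDiff)))).add
    ((c h.smooth).mul ((rr_contDiffAt h0).sub (c Ps_contDiff)))

lemma Ph_const {ε η : ℝ} {v : ℝ → ℝ} (h : VP ε η v) {t : ℝ} (h1 : 1 - η ≤ t) (h2 : t ≤ 1) :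
    Ph v t = Ph v 1 := by
  apply le_antisymm (h.Ph_mono h2)
  have := mono_aux (f := fun u => - Ph v u) h2 (fun u => (h.Ph_hasDerivAt u).neg)
    (fun u h3 h4 => by rw [h.zero u (h1.trans (h3.trans (le_abs_self u)))]; simp)
  linarith

lemma V1_const {ε η : ℝ} {v : ℝ → ℝ} (h : VP ε η v) {t : ℝ} (h1 : 1 - η ≤ t) (h2 : t ≤ 1) :
    V1 v t = Ph v 1 := by
  unfold V1
  rw [h.Ph_const h1 h2, h.zero t (h1.trans (le_abs_self t))]; ring

lemma HH_const {ε η : ℝ} {v : ℝ → ℝ} (h : VP ε η v) {t : ℝ} (h1 : 1 - η ≤ t) (h2 : t ≤ 1)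
    (q1 qs : ℝ) : HH v t q1 qs = Ph v 1 * q1 + (FF v 1 - Ph v 1) := by
  unfold HH
  rw [h.V1_const h1 h2, h.zero t (h1.trans (le_abs_self t))]
  have d : ∀ u, HasDerivAt (fun u => FF v u - Ph v 1 * P1 u) ((Ph v u - Ph v 1) * kk u) u :=
    fun u => ((h.FF_hasDerivAt u).sub ((P1_hasDerivAt u).const_mul _)).congr_deriv (by ring)
  have a := mono_aux h2 d (fun u h3 h4 => by rw [h.Ph_const (h1.trans h3) h4]; simp)
  have b := mono_aux h2 (fun u => (d u).neg)
    (fun u h3 h4 => by rw [h.Ph_const (h1.trans h3) h4]; simp)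
  simp only [Pi.neg_apply, P1_one] at a b
  linarith

lemma HH_neg {ε η : ℝ} {v : ℝ → ℝ} (h : VP ε η v) (t q1 qs : ℝ) :
    HH v (-t) (-q1) qs = HH v t q1 qs := by
  unfold HH; simp only [h.V1_neg, h.FF_neg, P1_neg, Ps_neg, h.even]; ring

lemma GG_plus {ε η : ℝ} {v : ℝ → ℝ} (h : VP ε η v) {p : E3} (h0 : 0 < p 0)
    (hp : rr p - p 0 < (η / 2) ^ 3 * (rr p + p 0)) :
    GG v p = Ph v 1 * p 0 + (FF v 1 - Ph v 1) := by
  unfold GG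
  split_ifs with h1
  · obtain ⟨h1, h2⟩ := abs_lt.1 h1
    obtain ⟨h3, h4⟩ := TT_ge h.eta_pos (show 0 < rr p + p 0 by linarith)
      (show 0 < rr p - p 0 by linarith) hp
    exact h.HH_const h3 h4 _ _
  · rw [abs_of_pos h0]

lemma GG_minus {ε η : ℝ} {v : ℝ → ℝ} (h : VP ε η v) {p : E3} (h0 : p 0 < 0)
    (hp : rr p + p 0 < (η / 2) ^ 3 * (rr p - p 0)) :
    GG v p = -Ph v 1 * p 0 + (FF v 1 - Ph v 1) := by
  unfold GG
  split_ifs with h1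
  · obtain ⟨h1, h2⟩ := abs_lt.1 h1
    obtain ⟨h3, h4⟩ := TT_ge h.eta_pos (show 0 < rr p - p 0 by linarith)
      (show 0 < rr p + p 0 by linarith) hp
    rw [TT_swap] at h3 h4
    rw [← h.HH_neg, show tp p = TT (rr p + p 0) (rr p - p 0) from rfl, h.HH_const h3 h4 _ _]
    ring
  · rw [abs_of_neg h0]; ring

lemma GG_plus_ev {ε η : ℝ} {v : ℝ → ℝ} (h : VP ε η v) {p : E3} (h0 : 0 < p 0)
    (hp : rr p - p 0 < (η / 2) ^ 3 * (rr p + p 0)) :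
    GG v =ᶠ[nhds p] fun p => Ph v 1 * p 0 + (FF v 1 - Ph v 1) := by
  have o1 : IsOpen {p : E3 | 0 < p 0} := isOpen_lt continuous_const (coord_cont 0)
  have o2 : IsOpen {p : E3 | rr p - p 0 < (η / 2) ^ 3 * (rr p + p 0)} :=
    isOpen_lt (rr_cont.sub (coord_cont 0)) (continuous_const.mul (rr_cont.add (coord_cont 0)))
  filter_upwards [o1.mem_nhds h0, o2.mem_nhds hp] with q hq hq2 using h.GG_plus hq hq2

lemma GG_minus_ev {ε η : ℝ} {v : ℝ → ℝ} (h : VP ε η v) {p : E3} (h0 : p 0 < 0)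
    (hp : rr p + p 0 < (η / 2) ^ 3 * (rr p - p 0)) :
    GG v =ᶠ[nhds p] fun p => -Ph v 1 * p 0 + (FF v 1 - Ph v 1) := by
  have o1 : IsOpen {p : E3 | p 0 < 0} := isOpen_lt (coord_cont 0) continuous_const
  have o2 : IsOpen {p : E3 | rr p + p 0 < (η / 2) ^ 3 * (rr p - p 0)} :=
    isOpen_lt (rr_cont.add (coord_cont 0)) (continuous_const.mul (rr_cont.sub (coord_cont 0)))
  filter_upwards [o1.mem_nhds h0, o2.mem_nhds hp] with q hq hq2 using h.GG_minus hq hq2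

lemma plus_cond {ε η : ℝ} {v : ℝ → ℝ} (h : VP ε η v) {p : E3} (h0 : 0 < p 0)
    (hp : rr p ≤ p 0) : rr p - p 0 < (η / 2) ^ 3 * (rr p + p 0) := by
  have h1 := rr_nonneg p
  have h2 := h.eta_pos
  have : 0 < (η / 2) ^ 3 * (rr p + p 0) := by positivity
  linarith

lemma minus_cond {ε η : ℝ} {v : ℝ → ℝ} (h : VP ε η v) {p : E3} (h0 : p 0 < 0)
    (hp : rr p ≤ -p 0) : rr p + p 0 < (η / 2) ^ 3 * (rr p - p 0) := by
  have h1 := rr_nonneg p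
  have h2 := h.eta_pos
  have : 0 < rr p - p 0 := by linarith
  have : 0 < (η / 2) ^ 3 * (rr p - p 0) := by positivity
  linarith

lemma GG_contDiffAt {ε η : ℝ} {v : ℝ → ℝ} (h : VP ε η v) {p : E3} (hp : p ≠ 0) :
    ContDiffAt ℝ (⊤ : ℕ∞) (GG v) p := by
  by_cases h1 : |p 0| < rr p
  · exact h.GG_contDiffAt_W0 h1
  push Not at h1
  rcases lt_trichotomy (p 0) 0 with h0 | h0 | h0
  · rw [abs_of_neg h0] at h1
    refine ContDiffAt.congr_of_eventuallyEq ?_ (h.GG_minus_ev h0 (h.minus_cond h0 h1))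
    exact (contDiffAt_const.mul (coord_contDiff 0).contDiffAt).add contDiffAt_const
  · exfalso
    rw [h0, abs_zero] at h1
    have h2 := le_antisymm h1 (rr_nonneg p)
    have := norm_rr p
    rw [h0, h2] at this
    simp at this
    exact hp this
  · rw [abs_of_pos h0] at h1
    refine ContDiffAt.congr_of_eventuallyEq ?_ (h.GG_plus_ev h0 (h.plus_cond h0 h1))
    exact (contDiffAt_const.mul (coord_contDiff 0).contDiffAt).add contDiffAt_const

lemma GG_grad_plus {ε η : ℝ} {v : ℝ → ℝ} (h : VP ε η v) {p : E3} (h0 : 0 < p 0)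
    (hp : rr p ≤ p 0) : gradient (GG v) p = !₂[Ph v 1, 0, 0] := by
  refine HasGradientAt.gradient (grad_of (L := Ph v 1 • pr 0) ?_ _ ?_)
  · exact (((coord_hasFDerivAt 0 p).const_mul (Ph v 1)).add_const _).congr_of_eventuallyEq
      (h.GG_plus_ev h0 (h.plus_cond h0 hp))
  · intro y; simp [pr_apply]

lemma GG_grad_minus {ε η : ℝ} {v : ℝ → ℝ} (h : VP ε η v) {p : E3} (h0 : p 0 < 0)
    (hp : rr p ≤ -p 0) : gradient (GG v) p = !₂[-Ph v 1, 0, 0] := by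
  refine HasGradientAt.gradient (grad_of (L := (-Ph v 1) • pr 0) ?_ _ ?_)
  · exact (((coord_hasFDerivAt 0 p).const_mul (-Ph v 1)).add_const _).congr_of_eventuallyEq
      (h.GG_minus_ev h0 (h.minus_cond h0 hp))
  · intro y; simp [pr_apply]

lemma GG_grad_W0 {ε η : ℝ} {v : ℝ → ℝ} (h : VP ε η v) {p : E3} (hp : |p 0| < rr p)
    (h1 : P1 (tp p) = p 0) (hs : Ps (tp p) = rr p) : gradient (GG v) p =
      !₂[V1 v (tp p), v (tp p) * (p 1 / rr p), v (tp p) * (p 2 / rr p)] := by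
  have h0 : 0 < rr p := (abs_nonneg _).trans_lt hp
  have ht := ((tp_contDiffAt hp).differentiableAt (by simp)).hasFDerivAt
  have dV : HasDerivAt (V1 v) (deriv (V1 v) (tp p)) (tp p) :=
    ((h.V1_contDiff.contDiffAt).differentiableAt (by simp)).hasDerivAt
  have dv : HasDerivAt v (deriv v (tp p)) (tp p) :=
    ((h.smooth.contDiffAt).differentiableAt (by simp)).hasDerivAt
  have key := (((h.FF_hasDerivAt (tp p)).comp_hasFDerivAt p ht).add
    ((dV.comp_hasFDerivAt p ht).mul
      ((coord_hasFDerivAt 0 p).sub ((P1_hasDerivAt (tp p)).comp_hasFDerivAt p ht)))).add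
    ((dv.comp_hasFDerivAt p ht).mul
      ((rr_hasFDerivAt h0).sub ((Ps_hasDerivAt (tp p)).comp_hasFDerivAt p ht)))
  refine HasGradientAt.gradient (grad_of (key.congr_of_eventuallyEq (GG_W0 v hp)) _ ?_)
  intro y
  simp [pr_apply, h1, hs, V1]
  ring

end VP

lemma mm_pos {x : E3} (hx : x ≠ 0) : 0 < √2 * ‖x‖ ^ 3 := by
  have hn : 0 < ‖x‖ := norm_pos_iff.2 hx
  have h2 := sqrt2_pos
  positivity

lemma ne_of_R {x : E3} (h : |x 0| < rr x) : x ≠ 0 := by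
  rintro rfl
  simp [rr] at h

lemma Rt_x {x : E3} (h : |x 0| < rr x) : Rt (-x 0 / rr x) = ‖x‖ / rr x := by
  have h0 : 0 < rr x := (abs_nonneg _).trans_lt h
  unfold Rt
  rw [show 1 + (-x 0 / rr x) ^ 2 = (‖x‖ / rr x) ^ 2 by
    rw [div_pow ‖x‖, norm_rr]; field_simp; ring]
  exact Real.sqrt_sq (by positivity)

lemma gu_R {x : E3} (h : |x 0| < rr x) : |gu x 0| < rr (gu x) ∧ tp (gu x) = -x 0 / rr x ∧
    P1 (-x 0 / rr x) = gu x 0 ∧ Ps (-x 0 / rr x) = rr (gu x) ∧ gu x 1 / rr (gu x) = x 1 / rr x ∧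
    gu x 2 / rr (gu x) = x 2 / rr x := by
  have h0 : 0 < rr x := (abs_nonneg _).trans_lt h
  have hx := ne_of_R h
  have hn : 0 < ‖x‖ := norm_pos_iff.2 hx
  have hm := mm_pos hx
  have h2 := sqrt2_pos
  obtain ⟨h3, h4⟩ := abs_lt.1 h
  have ha : 0 < rr x - x 0 := by linarith
  have hb : 0 < rr x + x 0 := by linarith
  have g1 := gu_sub x
  have g2 := gu_add x
  have p1 : 0 < (rr x + x 0) ^ 3 / (√2 * ‖x‖ ^ 3) := by positivity
  have p2 : 0 < (rr x - x 0) ^ 3 / (√2 * ‖x‖ ^ 3) := by positivity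
  refine ⟨abs_lt.2 ⟨by linarith, by linarith⟩, ?_, ?_, ?_, ?_, ?_⟩
  · unfold tp
    rw [g1, g2, TT_cube ha hb hm]
    field_simp
    ring
  · unfold P1
    rw [Rt_x h, gu0]
    field_simp
    ring
  · unfold Ps
    rw [Rt_x h, rr_gu]
    field_simp
  · rw [gu1, rr_gu]
    field_simp
  · rw [gu2, rr_gu]
    field_simp

lemma gu_plus {x : E3} (hx : x ≠ 0) (h : x 0 ≤ -rr x) : 0 < gu x 0 ∧ rr (gu x) ≤ gu x 0 := by
  have h0 := rr_nonneg x
  have hm := mm_pos hx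
  have g1 := gu_sub x
  have h1 : x 0 < 0 := by
    rcases h.lt_or_eq with h1 | h1
    · linarith
    · rcases h0.lt_or_eq with h2 | h2
      · linarith
      · exfalso
        have := norm_rr x
        rw [← h2, neg_zero] at h1
        rw [← h2, h1] at this
        simp at this
        exact hx this
  constructor
  · rw [gu0]
    have : 0 < -x 0 := by linarith
    have : 0 < 3 * rr x ^ 2 + x 0 ^ 2 := by nlinarith
    positivity
  · have : 0 ≤ (-(rr x + x 0)) ^ 3 / (√2 * ‖x‖ ^ 3) := by
      have : 0 ≤ -(rr x + x 0) := by linarith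
      positivity
    have e : (-(rr x + x 0)) ^ 3 / (√2 * ‖x‖ ^ 3) = -((rr x + x 0) ^ 3 / (√2 * ‖x‖ ^ 3)) := by ring
    linarith

def refl0 (x : E3) : E3 := !₂[-x 0, x 1, x 2]

lemma refl0_0 (x : E3) : refl0 x 0 = -x 0 := rfl
lemma refl0_1 (x : E3) : refl0 x 1 = x 1 := rfl
lemma refl0_2 (x : E3) : refl0 x 2 = x 2 := rfl
lemma rr_refl0 (x : E3) : rr (refl0 x) = rr x := rfl
lemma norm_refl0 (x : E3) : ‖refl0 x‖ = ‖x‖ := by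
  rw [norm3, norm3, refl0_0, refl0_1, refl0_2]; simp
lemma refl0_ne {x : E3} (hx : x ≠ 0) : refl0 x ≠ 0 := by
  rw [← norm_pos_iff] at *; rwa [norm_refl0]
lemma gu_refl0 (x : E3) : gu (refl0 x) = refl0 (gu x) := by
  ext i
  fin_cases i
  · show gu (refl0 x) 0 = - gu x 0
    rw [gu0, gu0, norm_refl0, rr_refl0, refl0_0]; ring
  · show gu (refl0 x) 1 = gu x 1
    rw [gu1, gu1, norm_refl0, rr_refl0, refl0_0, refl0_1]; ring
  · show gu (refl0 x) 2 = gu x 2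
    rw [gu2, gu2, norm_refl0, rr_refl0, refl0_0, refl0_2]; ring

lemma gu_minus {x : E3} (hx : x ≠ 0) (h : rr x ≤ x 0) : gu x 0 < 0 ∧ rr (gu x) ≤ -gu x 0 := by
  have := gu_plus (refl0_ne hx) (by rw [refl0_0, rr_refl0]; linarith)
  rw [gu_refl0, refl0_0, rr_refl0] at this
  exact ⟨by linarith [this.1], this.2⟩

namespace VP

lemma X_R {ε η : ℝ} {v : ℝ → ℝ} (h : VP ε η v) {x : E3} (hx : |x 0| < rr x) :
    gradient (GG v) (gu x) = !₂[V1 v (-x 0 / rr x), v (-x 0 / rr x) * (x 1 / rr x),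
      v (-x 0 / rr x) * (x 2 / rr x)] := by
  obtain ⟨a, b, c, d, e, f⟩ := gu_R hx
  rw [h.GG_grad_W0 a (by rw [b, c]) (by rw [b, d]), b, e, f]

lemma X_plus {ε η : ℝ} {v : ℝ → ℝ} (h : VP ε η v) {x : E3} (hx : x ≠ 0) (h0 : x 0 < 0)
    (h1 : (1 - η) * rr x ≤ -x 0) : gradient (GG v) (gu x) = !₂[Ph v 1, 0, 0] := by
  by_cases hR : |x 0| < rr x
  · have hr : 0 < rr x := (abs_nonneg _).trans_lt hR
    obtain ⟨h3, h4⟩ := abs_lt.1 hR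
    have a : 1 - η ≤ -x 0 / rr x := by rwa [le_div_iff₀ hr]
    have b : -x 0 / rr x ≤ 1 := by rw [div_le_one hr]; linarith
    rw [h.X_R hR, h.V1_const a b, h.zero _ (a.trans (le_abs_self _))]
    simp
  · push Not at hR
    rw [abs_of_neg h0] at hR
    obtain ⟨a, b⟩ := gu_plus hx (by linarith)
    exact h.GG_grad_plus a b

lemma X_minus {ε η : ℝ} {v : ℝ → ℝ} (h : VP ε η v) {x : E3} (hx : x ≠ 0) (h0 : 0 < x 0)
    (h1 : (1 - η) * rr x ≤ x 0) : gradient (GG v) (gu x) = !₂[-Ph v 1, 0, 0] := by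
  by_cases hR : |x 0| < rr x
  · have hr : 0 < rr x := (abs_nonneg _).trans_lt hR
    obtain ⟨h3, h4⟩ := abs_lt.1 hR
    have a : 1 - η ≤ x 0 / rr x := by rwa [le_div_iff₀ hr]
    have b : x 0 / rr x ≤ 1 := by rw [div_le_one hr]; linarith
    rw [h.X_R hR, neg_div, h.V1_neg, h.even, h.V1_const a b, h.zero _ (a.trans (le_abs_self _))]
    simp
  · push Not at hR
    rw [abs_of_pos h0] at hR
    obtain ⟨a, b⟩ := gu_minus hx hR
    exact h.GG_grad_minus a b

def XX (v : ℝ → ℝ) (i : Fin 3) (x : E3) : ℝ := gradient (GG v) (gu x) i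

lemma XX_contDiffAt {ε η : ℝ} {v : ℝ → ℝ} (h : VP ε η v) {x : E3} (hx : x ≠ 0) (i : Fin 3) :
    ContDiffAt ℝ 1 (XX v i) x := by
  have h1 : ContDiffAt ℝ 1 (fun p => fderiv ℝ (GG v) p) (gu x) :=
    (h.GG_contDiffAt (gu_ne_zero hx)).fderiv_right (m := 1) (by norm_cast)
  have h2 : ContDiffAt ℝ 1 (fun p => gradient (GG v) p) (gu x) :=
    ((InnerProductSpace.toDual ℝ E3).symm.contDiff.contDiffAt).comp (gu x) h1
  have h3 : ContDiffAt ℝ 1 (fun x => gradient (GG v) (gu x)) x :=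
    ContDiffAt.comp (g := fun p => gradient (GG v) p) (f := gu) x h2 ((gu_contDiffAt hx).of_le (by norm_cast))
  exact contDiffAt_euclidean.1 h3 i

def ee (i : Fin 3) : E3 := EuclideanSpace.single i 1

lemma div_const {v : ℝ → ℝ} {x : E3} {w : E3} {s : Set E3} (hs : IsOpen s) (hxs : x ∈ s)
    (hw : ∀ y ∈ s, gradient (GG v) (gu y) = w) (i : Fin 3) : fderiv ℝ (XX v i) x = 0 := by
  have : XX v i =ᶠ[nhds x] fun _ => w i := by
    filter_upwards [hs.mem_nhds hxs] with y hy
    unfold XX; rw [hw y hy]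
  rw [this.fderiv_eq]; simp

lemma div_R {ε η : ℝ} {v : ℝ → ℝ} (h : VP ε η v) {x : E3} (hx : |x 0| < rr x) :
    fderiv ℝ (XX v 0) x (ee 0) + fderiv ℝ (XX v 1) x (ee 1) + fderiv ℝ (XX v 2) x (ee 2) = 0 := by
  have h0 : 0 < rr x := (abs_nonneg _).trans_lt hx
  have hr := rr_hasFDerivAt h0
  have ev : ∀ i, XX v i =ᶠ[nhds x] fun x => (!₂[V1 v (-x 0 / rr x), v (-x 0 / rr x) * (x 1 / rr x),
      v (-x 0 / rr x) * (x 2 / rr x)] : E3) i := by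
    intro i
    filter_upwards [W0_open.mem_nhds hx] with y hy
    unfold XX; rw [h.X_R hy]
  have ht := fdiv (coord_hasFDerivAt 0 x).neg hr h0.ne'
  set T := -x 0 / rr x with hT
  have dv : HasDerivAt v (deriv v T) T :=
    ((h.smooth.contDiffAt).differentiableAt (by simp)).hasDerivAt
  have dV : HasDerivAt (V1 v) (2 * v T - (v T + T * deriv v T)) T := by
    have := (h.Ph_hasDerivAt T).sub ((hasDerivAt_id T).mul dv)
    refine this.congr_deriv ?_
    simp
  have d0 := (dV.comp_hasFDerivAt x ht).congr_of_eventuallyEq (ev 0)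
  have dvt := dv.comp_hasFDerivAt x ht
  have d1 := (dvt.mul (fdiv (coord_hasFDerivAt 1 x) hr h0.ne')).congr_of_eventuallyEq (ev 1)
  have d2 := (dvt.mul (fdiv (coord_hasFDerivAt 2 x) hr h0.ne')).congr_of_eventuallyEq (ev 2)
  rw [d0.fderiv, d1.fderiv, d2.fderiv]
  have hsq := rr_sq x
  simp [pr_apply, ee, ← hT]
  generalize deriv v T = w
  generalize v T = z
  rw [hT]
  field_simp
  have e : x 2 ^ 2 = rr x ^ 2 - x 1 ^ 2 := by linarith
  rw [e]
  ring

lemma div_X {ε η : ℝ} {v : ℝ → ℝ} (h : VP ε η v) {x : E3} (hx : x ≠ 0) :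
    fderiv ℝ (XX v 0) x (ee 0) + fderiv ℝ (XX v 1) x (ee 1) + fderiv ℝ (XX v 2) x (ee 2) = 0 := by
  by_cases hR : |x 0| < rr x
  · exact h.div_R hR
  push Not at hR
  have hη := h.eta_pos
  have h0 := rr_nonneg x
  rcases lt_trichotomy (x 0) 0 with h1 | h1 | h1
  · rw [abs_of_neg h1] at hR
    have o1 : IsOpen {x : E3 | x 0 < 0} := isOpen_lt (coord_cont 0) continuous_const
    have o2 : IsOpen {x : E3 | (1 - η) * rr x < -x 0} :=
      isOpen_lt (continuous_const.mul rr_cont) (coord_cont 0).neg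
    have m : x ∈ {x : E3 | x 0 < 0} ∩ {x : E3 | (1 - η) * rr x < -x 0} := by
      refine ⟨h1, ?_⟩
      show (1 - η) * rr x < -x 0
      rcases h0.lt_or_eq with h2 | h2
      · nlinarith
      · rw [← h2]; linarith
    have key := div_const (v := v) (w := !₂[Ph v 1, 0, 0]) (o1.inter o2) m (fun y hy =>
      h.X_plus (by rintro rfl; simpa using hy.1) hy.1 (le_of_lt hy.2))
    simp [key]
  · exfalso
    rw [h1, abs_zero] at hR
    have h2 := le_antisymm hR h0
    have := norm_rr x
    rw [h1, h2] at this
    simp at this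
    exact hx this
  · rw [abs_of_pos h1] at hR
    have o1 : IsOpen {x : E3 | 0 < x 0} := isOpen_lt continuous_const (coord_cont 0)
    have o2 : IsOpen {x : E3 | (1 - η) * rr x < x 0} :=
      isOpen_lt (continuous_const.mul rr_cont) (coord_cont 0)
    have m : x ∈ {x : E3 | 0 < x 0} ∩ {x : E3 | (1 - η) * rr x < x 0} := by
      refine ⟨h1, ?_⟩
      show (1 - η) * rr x < x 0
      rcases h0.lt_or_eq with h2 | h2
      · nlinarith
      · rw [← h2]; linarith
    have key := div_const (v := v) (w := !₂[-Ph v 1, 0, 0]) (o1.inter o2) m (fun y hy =>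
      h.X_minus (by rintro rfl; simpa using hy.1) hy.1 (le_of_lt hy.2))
    simp [key]

end VP

lemma integral_fderiv_zero {f : E3 → ℝ} (hf : ContDiff ℝ 1 f) (hc : HasCompactSupport f) (e : E3) :
    Integrable (fun x => fderiv ℝ f x e) ∧ ∫ x, fderiv ℝ f x e = 0 := by
  have c1 : Continuous (fun x => fderiv ℝ f x e) :=
    (hf.continuous_fderiv (by norm_num)).clm_apply continuous_const
  have hi : Integrable (fun x => fderiv ℝ f x e) := c1.integrable_of_hasCompactSupport
    (hc.fderiv_apply (𝕜 := ℝ) e)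
  refine ⟨hi, ?_⟩
  have := integral_mul_fderiv_eq_neg_fderiv_mul_of_integrable (μ := volume) (𝕜 := ℝ)
    (f := fun _ : E3 => (1 : ℝ)) (g := f) (v := e) (by simp) (by simpa using hi)
    (by simpa using hf.continuous.integrable_of_hasCompactSupport hc)
    (fun x _ => differentiableAt_const _)
    (fun x _ => (hf.differentiable (by norm_num)) x)
  simpa using this

lemma gradient_coord {ψ : E3 → ℝ} {x : E3} (hψ : DifferentiableAt ℝ ψ x) (i : Fin 3) :
    gradient ψ x i = fderiv ℝ ψ x (VP.ee i) := by
  have h := hψ.hasGradientAt.hasFDerivAt.fderiv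
  rw [h, InnerProductSpace.toDual_apply_apply, inner3]
  fin_cases i <;> simp [VP.ee]

namespace VP

lemma part_i {ε η : ℝ} {v : ℝ → ℝ} (h : VP ε η v) (ψ : E3 → ℝ) (hψ : ContDiff ℝ (⊤ : ℕ∞) ψ)
    (hc : HasCompactSupport ψ) (hs : tsupport ψ ⊆ ball (0 : E3) 1 \ {0}) :
    ∫ x in ball (0 : E3) 1, ⟪gradient (GG v) (gradient u0 x), gradient ψ x⟫ = 0 := by
  have hψ1 : ContDiff ℝ 1 ψ := hψ.of_le (by norm_cast)
  have hd : Differentiable ℝ ψ := hψ1.differentiable (by norm_num)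
  have off : ∀ x, x ∉ tsupport ψ → ψ =ᶠ[nhds x] 0 := fun x hx =>
    notMem_tsupport_iff_eventuallyEq.1 hx
  have fC : ∀ i, ContDiff ℝ 1 (fun x => XX v i x * ψ x) := by
    intro i
    rw [contDiff_iff_contDiffAt]
    intro x
    by_cases hx : x ∈ tsupport ψ
    · exact (h.XX_contDiffAt (hs hx).2 i).mul hψ1.contDiffAt
    · refine ContDiffAt.congr_of_eventuallyEq (contDiffAt_const (c := (0:ℝ))) ?_
      filter_upwards [off x hx] with y hy
      rw [hy]; simp
  have fS : ∀ i, HasCompactSupport (fun x => XX v i x * ψ x) := fun i => hc.mul_left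
  have I := fun i => integral_fderiv_zero (fC i) (fS i) (ee i)
  have eq : ∀ x, ⟪gradient (GG v) (gradient u0 x), gradient ψ x⟫ =
      fderiv ℝ (fun x => XX v 0 x * ψ x) x (ee 0) + fderiv ℝ (fun x => XX v 1 x * ψ x) x (ee 1)
      + fderiv ℝ (fun x => XX v 2 x * ψ x) x (ee 2) := by
    intro x
    by_cases hx : x ∈ tsupport ψ
    · have x0 : x ≠ 0 := (hs hx).2
      have F : ∀ i, fderiv ℝ (fun x => XX v i x * ψ x) x (ee i) =
          XX v i x * fderiv ℝ ψ x (ee i) + ψ x * fderiv ℝ (XX v i) x (ee i) := by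
        intro i
        have := (((h.XX_contDiffAt x0 i).differentiableAt (by norm_num)).hasFDerivAt.mul
          (hd x).hasFDerivAt).fderiv
        have e : (fun x => XX v i x * ψ x) = XX v i * ψ := rfl
        rw [e, this]
        simp
      have dz := h.div_X x0
      rw [gradient_u0 x0, inner3, F, F, F, gradient_coord (hd x), gradient_coord (hd x),
        gradient_coord (hd x)]
      have : ψ x * (fderiv ℝ (XX v 0) x (ee 0) + fderiv ℝ (XX v 1) x (ee 1)
        + fderiv ℝ (XX v 2) x (ee 2)) = 0 := by rw [dz, mul_zero]
      unfold XX at *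
      linarith
    · have F : ∀ i, fderiv ℝ (fun x => XX v i x * ψ x) x = 0 := by
        intro i
        have : (fun x => XX v i x * ψ x) =ᶠ[nhds x] fun _ => 0 := by
          filter_upwards [off x hx] with y hy
          rw [hy]; simp
        rw [this.fderiv_eq]; simp
      have G : fderiv ℝ ψ x = 0 := by rw [(off x hx).fderiv_eq]; simp
      rw [inner3, gradient_coord (hd x), gradient_coord (hd x), gradient_coord (hd x), F, F, F, G]
      simp
  rw [setIntegral_eq_integral_of_forall_compl_eq_zero]
  · simp only [eq]
    rw [integral_add ((I 0).1.fun_add (I 1).1) (I 2).1, integral_add (I 0).1 (I 1).1, (I 0).2, (I 1).2,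
      (I 2).2]
    simp
  · intro x hx
    have : x ∉ tsupport ψ := fun h => hx (hs h).1
    have G : fderiv ℝ ψ x = 0 := by rw [(off x this).fderiv_eq]; simp
    rw [inner3, gradient_coord (hd x), gradient_coord (hd x), gradient_coord (hd x), G]
    simp

end VP

lemma cube_low {α β : ℝ} (ha : 0 ≤ α) (h : α ^ 2 + β ^ 2 = 2) :
    (1 - 3 / 4 * β ^ 2) * (2 * √2) ≤ α ^ 3 := by
  have h2 := sqrt2_pos
  obtain ⟨c, rfl⟩ : ∃ c, α = √2 * c := ⟨α / √2, by field_simp⟩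
  have hc : 0 ≤ c := by by_contra hc; push Not at hc; nlinarith
  rw [mul_pow, sqrt2_sq] at h
  rw [mul_pow, sqrt2_cube]
  have : β ^ 2 = 2 - 2 * c ^ 2 := by linarith
  rw [this]
  have k : 0 ≤ (c - 1) ^ 2 * (2 * c + 1) := by positivity
  nlinarith [mul_nonneg h2.le k]

lemma cube_up {α β : ℝ} (ha : 0 ≤ α) (hb : 0 ≤ β) (hb3 : β ≤ 0.3) (h : α ^ 2 + β ^ 2 = 2) :
    α ^ 3 ≤ (1 - 0.725 * β ^ 2) * (2 * √2) := by
  have h2 := sqrt2_pos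
  obtain ⟨c, rfl⟩ : ∃ c, α = √2 * c := ⟨α / √2, by field_simp⟩
  have hc : 0 ≤ c := by by_contra hc; push Not at hc; nlinarith
  rw [mul_pow, sqrt2_sq] at h
  rw [mul_pow, sqrt2_cube]
  have hz : β ^ 2 ≤ 0.09 := by nlinarith
  have hz0 := sq_nonneg β
  set z := β ^ 2
  have hc2 : c ^ 2 = 1 - z / 2 := by linarith
  have k : c ^ 3 ≤ 1 - 0.725 * z := by
    apply le_of_sq_le_sq _ (by linarith)
    rw [show (c ^ 3) ^ 2 = (c ^ 2) ^ 3 by ring, hc2]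
    nlinarith [mul_nonneg hz0 (sub_nonneg.2 hz), mul_nonneg hz0 hz0]
  nlinarith

namespace VP

lemma DD_sep {ε η : ℝ} {v : ℝ → ℝ} (h : VP ε η v) (hε : 0 ≤ ε) {s α β α' β' q1 qs : ℝ}
    (ha : 0 < α) (hb : 0 < β) (hab : α ^ 2 + β ^ 2 = 2) (hs : s = (α - β) / (α + β))
    (hp1 : P1 s * (2 * √2) = α ^ 3 - β ^ 3) (hps : (Ps s - P1 s) * √2 = β ^ 3)
    (ha' : 0 ≤ α') (hb' : 0 ≤ β') (hab' : α' ^ 2 + β' ^ 2 = 2)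
    (hq : q1 * (2 * √2) = α' ^ 3 + β' ^ 3) (hqs : (q1 - qs) * √2 = β' ^ 3)
    (hq1 : q1 ≤ 1) (hq0 : 1 / √2 ≤ q1) :
    -(100000 * ε) * ((q1 - P1 s) ^ 2 + (qs - Ps s) ^ 2) ≤ DD v s q1 qs := by
  have h2 := sqrt2_pos
  have g1 := sqrt2_gt
  have g2 := sqrt2_lt
  have hs1 : s ≤ 1 := by rw [hs, div_le_one (by positivity)]; linarith
  have hs0 : -1 ≤ s := by rw [hs, le_div_iff₀ (by positivity)]; linarith
  have hb3 : 0 ≤ β' ^ 3 := by positivity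
  have hqsle : qs ≤ q1 := by
    by_contra hc; push Not at hc
    have := mul_neg_of_neg_of_pos (sub_neg.2 hc) h2
    linarith
  have D := h.DD_ge hε hs0 hs1 hq1 hq0 hqsle
  have P0 : -1 ≤ P1 s := by
    have := P1_mono (s := -1) (t := s) le_rfl hs0 hs1
    rwa [P1_neg, P1_one] at this
  have P1' : P1 s ≤ 1 := by
    have := P1_mono hs0 hs1 le_rfl
    rwa [P1_one] at this
  rcases le_total 0.3 β with hβ | hβ
  · have b3 : (0.3 : ℝ) ^ 3 ≤ β ^ 3 := by gcongr
    have e1 : 0.019 ≤ Ps s - P1 s := by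
      by_contra hc; push Not at hc
      have := mul_lt_mul_of_pos_right hc h2
      linarith
    have e2 : 0.00018 ≤ (q1 - P1 s) ^ 2 + (qs - Ps s) ^ 2 := by
      have : (0.019 : ℝ) ^ 2 ≤ ((q1 - P1 s) - (qs - Ps s)) ^ 2 :=
        pow_le_pow_left₀ (by norm_num) (by linarith) 2
      linarith [sq_nonneg ((q1 - P1 s) + (qs - Ps s))]
    have e3 : (1 - P1 s) ^ 2 ≤ 4 := by
      have := mul_nonneg (show 0 ≤ 1 + P1 s by linarith) (show 0 ≤ 3 - P1 s by linarith)
      linarith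
    have f2 := mul_le_mul_of_nonneg_left e2 hε
    have f3 := mul_le_mul_of_nonneg_left e3 hε
    linarith
  have low := cube_low ha.le hab
  have low' := cube_low ha' hab'
  have up := cube_up ha.le hb.le hβ hab
  have hβ2 : 0 < β ^ 2 := by positivity
  have hβ3 : 0 < β ^ 3 := by positivity
  have hβ3' : β ^ 3 ≤ 0.3 * β ^ 2 := by
    have := mul_le_mul_of_nonneg_right hβ hβ2.le
    linarith
  have m1 : (1 - P1 s) * (2 * √2) ≤ 3 / 4 * β ^ 2 * (2 * √2) + β ^ 3 := by linarith
  rcases le_total (0.9 * β) β' with hc | hc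
  · have c3 : (0.9 * β) ^ 3 ≤ β' ^ 3 := by gcongr
    have hα : 1.38 ≤ α := by
      by_contra hc; push Not at hc
      have := pow_le_pow_left₀ ha.le hc.le 2
      have := pow_le_pow_left₀ hb.le hβ 2
      linarith
    have hs2 : 1 / 200 ≤ s := by rw [hs, le_div_iff₀ (by positivity)]; linarith
    have N := h.DD_ge_near (qs := qs) hs2 hs1 hq1
    have d1 : (1 - s) ≤ √2 * β := by
      rw [hs, one_sub_div (by positivity), div_le_iff₀ (by positivity)]
      have : √2 ≤ α + β := by
        apply le_of_sq_le_sq _ (by positivity)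
        rw [sqrt2_sq]; linarith [mul_pos ha hb]
      have := mul_le_mul_of_nonneg_left this (show 0 ≤ √2 * β by positivity)
      have e : √2 * β * √2 = √2 ^ 2 * β := by ring
      rw [e, sqrt2_sq] at this
      linarith
    have d2 : (1 - s) * (1 - P1 s) * (2 * √2) ≤ (√2 * β) * (3 / 4 * β ^ 2 * (2 * √2) + β ^ 3) := by
      have := mul_le_mul d1 m1 (mul_nonneg (by linarith) (by positivity)) (by positivity)
      linarith
    have d3 : (√2 * β) * (3 / 4 * β ^ 2 * (2 * √2) + β ^ 3) ≤ 2 * (1.5 + 0.213) * β ^ 3 := by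
      have : (√2 * β) * (3 / 4 * β ^ 2 * (2 * √2) + β ^ 3) = 3 / 2 * √2 ^ 2 * β ^ 3
        + √2 * β * β ^ 3 := by ring
      rw [this, sqrt2_sq]
      have : √2 * β ≤ 1.42 * 0.3 := mul_le_mul g2.le hβ hb.le (by norm_num)
      have := mul_le_mul_of_nonneg_right this hβ3.le
      linarith
    have d4 : 0 ≤ (Ps s - P1 s) + (q1 - qs) - (1 - s) * (1 - P1 s) := by
      by_contra hc; push Not at hc
      have := mul_neg_of_neg_of_pos hc h2
      linarith
    have := mul_nonneg (h.nonneg s) d4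
    have : 0 ≤ (100000 * ε) * ((q1 - P1 s) ^ 2 + (qs - Ps s) ^ 2) := by positivity
    linarith
  · have c2 : β' ^ 2 ≤ 0.81 * β ^ 2 := by
      have := pow_le_pow_left₀ hb' hc 2
      linarith
    have hs2 : 0 < 2 * √2 := by positivity
    have k1 : 0.1175 * β ^ 2 ≤ q1 - P1 s := by
      by_contra hc; push Not at hc
      have := mul_lt_mul_of_pos_right hc hs2
      have := mul_le_mul_of_nonneg_right c2 hs2.le
      linarith
    have k2 : 1 - P1 s ≤ 0.9 * β ^ 2 := by
      by_contra hc; push Not at hc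
      have := mul_lt_mul_of_pos_right hc hs2
      have := mul_le_mul_of_nonneg_right (show 1 ≤ √2 by linarith) hβ2.le
      linarith
    have k3 : (1 - P1 s) ^ 2 ≤ (8 * (q1 - P1 s)) ^ 2 := by
      apply pow_le_pow_left₀ (by linarith); linarith
    linarith [mul_nonneg hε (sub_nonneg.2 k3), mul_nonneg hε (sq_nonneg (q1 - P1 s)),
      mul_nonneg hε (sq_nonneg (qs - Ps s))]

end VP

lemma cubic_le {w : ℝ} (hw : 0 ≤ w) : 3 * w - 2 * w ^ 3 ≤ √2 := by
  have h2 := sqrt2_pos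
  have h : 0 ≤ 2 * (w - √2 / 2) ^ 2 * (w + √2) := by positivity
  have e : 2 * (w - √2 / 2) ^ 2 * (w + √2) = 2 * w ^ 3 - 3 * w + √2 := by
    linear_combination (-(3 / 2) * w + √2 / 2) * sqrt2_sq
  linarith

lemma unit_ne {x : E3} (hx : ‖x‖ = 1) : x ≠ 0 := by
  rintro rfl; simp at hx

lemma unit_sq {x : E3} (hx : ‖x‖ = 1) : x 0 ^ 2 + rr x ^ 2 = 1 := by
  rw [← norm_rr, hx]; norm_num

lemma rr_gu_le {x : E3} (hx : ‖x‖ = 1) : rr (gu x) ≤ 1 := by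
  rw [rr_gu, hx, div_le_one (by positivity)]
  have := cubic_le (rr_nonneg x)
  have e : x 0 ^ 2 = 1 - rr x ^ 2 := by linarith [unit_sq hx]
  rw [e]; linarith

lemma sub_eq' {x : E3} (hx : ‖x‖ = 1) : (rr (gu x) - gu x 0) * √2 = (rr x + x 0) ^ 3 := by
  rw [gu_sub, hx]; have := sqrt2_pos; field_simp

lemma add_eq' {x : E3} (hx : ‖x‖ = 1) : (rr (gu x) + gu x 0) * √2 = (rr x - x 0) ^ 3 := by
  rw [gu_add, hx]; have := sqrt2_pos; field_simp

lemma Lp_bounds {x : E3} (hx : ‖x‖ = 1) (h : x 0 ≤ -rr x) :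
    1 / √2 ≤ gu x 0 ∧ gu x 0 ≤ 1 ∧ rr (gu x) ≤ gu x 0 := by
  have h0 := rr_nonneg x
  have hu := unit_sq hx
  have h2 := sqrt2_pos
  have e : rr x ^ 2 = 1 - x 0 ^ 2 := by linarith
  have hw : 0 ≤ -x 0 := by linarith
  have q : gu x 0 = (3 * (-x 0) - 2 * (-x 0) ^ 3) / √2 := by
    rw [gu0, hx, e]; ring
  refine ⟨?_, ?_, (gu_plus (unit_ne hx) h).2⟩
  · rw [q]
    apply div_le_div_of_nonneg_right _ h2.le
    set c := -x 0
    have hc : c ^ 2 = x 0 ^ 2 := by ring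
    have c1 : c ≤ 1 := by nlinarith
    have c2 : 1 / 2 ≤ c ^ 2 := by nlinarith
    nlinarith [mul_nonneg (sub_nonneg.2 c1) (show 0 ≤ 2 * c ^ 2 + 2 * c - 1 by linarith)]
  · rw [q, div_le_one h2]
    exact cubic_le hw

lemma Lm_bounds {x : E3} (hx : ‖x‖ = 1) (h : rr x ≤ x 0) :
    1 / √2 ≤ -gu x 0 ∧ -gu x 0 ≤ 1 ∧ rr (gu x) ≤ -gu x 0 := by
  have := Lp_bounds (x := refl0 x) (by rw [norm_refl0, hx]) (by rw [refl0_0, rr_refl0]; linarith)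
  rwa [gu_refl0, refl0_0, rr_refl0] at this

/-- the rotational defect -/
def rho (x q : E3) : ℝ := rr q - (q 1 * x 1 + q 2 * x 2) / rr x

lemma rho_nonneg {x : E3} (hx : 0 < rr x) (q : E3) : 0 ≤ rho x q := by
  unfold rho
  rw [sub_nonneg, div_le_iff₀ hx]
  apply le_of_sq_le_sq _ (mul_nonneg (rr_nonneg q) hx.le)
  rw [mul_pow, rr_sq, rr_sq]
  nlinarith [sq_nonneg (q 1 * x 2 - q 2 * x 1)]

lemma R_coord {x : E3} (hx : |x 0| < rr x) : gu x 1 = rr (gu x) * (x 1 / rr x) ∧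
    gu x 2 = rr (gu x) * (x 2 / rr x) := by
  obtain ⟨a, b, c, d, e, f⟩ := gu_R hx
  have h0 : 0 < rr (gu x) := (abs_nonneg _).trans_lt a
  rw [← e, ← f]
  constructor <;> field_simp

lemma dist_R {x : E3} (hx : |x 0| < rr x) (q : E3) :
    ‖gu x - q‖ ^ 2 = (q 0 - gu x 0) ^ 2 + (rr q - rr (gu x)) ^ 2 + 2 * rr (gu x) * rho x q := by
  have h0 : 0 < rr x := (abs_nonneg _).trans_lt hx
  obtain ⟨a, b⟩ := R_coord hx
  rw [norm3_sq]
  simp only [PiLp.sub_apply]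
  rw [a, b]
  unfold rho
  have e1 := rr_sq x
  have e2 := rr_sq q
  have e3 : (x 1 / rr x) ^ 2 + (x 2 / rr x) ^ 2 = 1 := by
    rw [div_pow, div_pow, ← add_div, ← e1]; field_simp
  have e4 : (q 1 * x 1 + q 2 * x 2) / rr x = q 1 * (x 1 / rr x) + q 2 * (x 2 / rr x) := by
    field_simp
  rw [e4]
  linear_combination rr (gu x) ^ 2 * e3 - e2

namespace VP

lemma S_R {ε η : ℝ} {v : ℝ → ℝ} (h : VP ε η v) {x : E3} (hx : |x 0| < rr x) (q : E3) :
    GG v q - GG v (gu x) - ⟪gradient (GG v) (gu x), q - gu x⟫ =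
      GG v q - FF v (-x 0 / rr x) - V1 v (-x 0 / rr x) * (q 0 - gu x 0)
       - v (-x 0 / rr x) * (rr q - rr (gu x)) + v (-x 0 / rr x) * rho x q := by
  have h0 : 0 < rr x := (abs_nonneg _).trans_lt hx
  obtain ⟨g1, g2, g3, g4, -, -⟩ := gu_R hx
  obtain ⟨a, b⟩ := R_coord hx
  have hG : GG v (gu x) = FF v (-x 0 / rr x) := by
    unfold GG HH
    rw [if_pos g1, g2, g3, g4]; ring
  rw [hG, h.X_R hx, inner3]
  simp only [PiLp.sub_apply]
  rw [a, b]
  unfold rho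
  have e1 := rr_sq x
  have e3 : (x 1 / rr x) ^ 2 + (x 2 / rr x) ^ 2 = 1 := by
    rw [div_pow, div_pow, ← add_div, ← e1]; field_simp
  have e4 : (q 1 * x 1 + q 2 * x 2) / rr x = q 1 * (x 1 / rr x) + q 2 * (x 2 / rr x) := by
    field_simp
  rw [e4]
  simp
  linear_combination v (-x 0 / rr x) * rr (gu x) * e3

lemma GG_R {v : ℝ → ℝ} {x : E3} (hx : |x 0| < rr x) : GG v (gu x) = FF v (-x 0 / rr x) := by
  obtain ⟨g1, g2, g3, g4, -, -⟩ := gu_R hx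
  unfold GG HH
  rw [if_pos g1, g2, g3, g4]; ring

lemma GG_Lp {ε η : ℝ} {v : ℝ → ℝ} (h : VP ε η v) {x : E3} (hx : x ≠ 0) (h0 : x 0 ≤ -rr x) :
    GG v (gu x) = Ph v 1 * gu x 0 + (FF v 1 - Ph v 1) := by
  obtain ⟨a, b⟩ := gu_plus hx h0
  exact h.GG_plus a (h.plus_cond a b)

lemma GG_Lm {ε η : ℝ} {v : ℝ → ℝ} (h : VP ε η v) {x : E3} (hx : x ≠ 0) (h0 : rr x ≤ x 0) :
    GG v (gu x) = -Ph v 1 * gu x 0 + (FF v 1 - Ph v 1) := by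
  obtain ⟨a, b⟩ := gu_minus hx h0
  exact h.GG_minus a (h.minus_cond a b)

lemma tri (x : E3) : |x 0| < rr x ∨ x 0 ≤ -rr x ∨ rr x ≤ x 0 := by
  by_cases h : |x 0| < rr x
  · exact Or.inl h
  · push Not at h
    rcases le_abs.1 h with h | h
    · exact Or.inr (Or.inr h)
    · exact Or.inr (Or.inl (by linarith))

lemma t_bounds {x : E3} (hx : |x 0| < rr x) : -1 ≤ -x 0 / rr x ∧ -x 0 / rr x ≤ 1 := by
  have h0 : 0 < rr x := (abs_nonneg _).trans_lt hx
  obtain ⟨a, b⟩ := abs_lt.1 hx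
  rw [le_div_iff₀ h0, div_le_one h0]
  constructor <;> linarith

lemma RLp_eq {ε η : ℝ} {v : ℝ → ℝ} (h : VP ε η v) {x y : E3} (hR : |x 0| < rr x) (hy : y ≠ 0)
    (hL : y 0 ≤ -rr y) : GG v (gu y) - GG v (gu x) - ⟪gradient (GG v) (gu x), gu y - gu x⟫ =
      DD v (-x 0 / rr x) (gu y 0) (rr (gu y)) + v (-x 0 / rr x) * rho x (gu y) := by
  obtain ⟨g1, g2, g3, g4, -, -⟩ := gu_R hR
  rw [h.S_R hR, h.GG_Lp hy hL]
  unfold DD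
  rw [g3, g4]; ring

lemma RLm_eq {ε η : ℝ} {v : ℝ → ℝ} (h : VP ε η v) {x y : E3} (hR : |x 0| < rr x) (hy : y ≠ 0)
    (hL : rr y ≤ y 0) : GG v (gu y) - GG v (gu x) - ⟪gradient (GG v) (gu x), gu y - gu x⟫ =
      DD v (-(-x 0 / rr x)) (-gu y 0) (rr (gu y)) + v (-x 0 / rr x) * rho x (gu y) := by
  obtain ⟨g1, g2, g3, g4, -, -⟩ := gu_R hR
  rw [h.S_R hR, h.GG_Lm hy hL]
  unfold DD
  rw [h.V1_neg, P1_neg, Ps_neg, h.FF_neg, h.even, g3, g4]; ring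

lemma RR_eq {ε η : ℝ} {v : ℝ → ℝ} (h : VP ε η v) {x y : E3} (hR : |x 0| < rr x)
    (hy : |y 0| < rr y) : GG v (gu y) - GG v (gu x) - ⟪gradient (GG v) (gu x), gu y - gu x⟫ =
      S2 v (-x 0 / rr x) (-y 0 / rr y) + v (-x 0 / rr x) * rho x (gu y) := by
  obtain ⟨g1, g2, g3, g4, -, -⟩ := gu_R hR
  obtain ⟨k1, k2, k3, k4, -, -⟩ := gu_R hy
  rw [h.S_R hR, GG_R hy]
  unfold S2
  rw [g3, g4, k3, k4]

lemma part_iii {ε η : ℝ} {v : ℝ → ℝ} (h : VP ε η v) (hε : 0 ≤ ε) {x y : E3} (hx : ‖x‖ = 1)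
    (hy : ‖y‖ = 1) : -(100000 * ε) * ‖gu x - gu y‖ ^ 2 ≤
      GG v (gu y) - GG v (gu x) - ⟪gradient (GG v) (gu x), gu y - gu x⟫ := by
  have x0 := unit_ne hx
  have y0 := unit_ne hy
  have hN : 0 ≤ (100000 * ε) * ‖gu x - gu y‖ ^ 2 := by positivity
  have hPh := h.Ph_one_nonneg
  have h2 := sqrt2_pos
  rcases tri x with hR | hL | hL
  · have hr : 0 < rr x := (abs_nonneg _).trans_lt hR
    have hrho := rho_nonneg hr (gu y)
    have hv := mul_nonneg (h.nonneg (-x 0 / rr x)) hrho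
    obtain ⟨t1, t2⟩ := t_bounds hR
    obtain ⟨g1, g2, g3, g4, -, -⟩ := gu_R hR
    have hD := dist_R hR (gu y)
    have hrr : 0 ≤ 2 * rr (gu x) * rho x (gu y) := by
      have := rr_nonneg (gu x); positivity
    have hD' := mul_nonneg hε hrr
    have hD2 := mul_nonneg hε (sq_nonneg (rr (gu y) - rr (gu x)))
    have hD1 := mul_nonneg hε (sq_nonneg (gu y 0 - gu x 0))
    obtain ⟨a1, a2⟩ := abs_lt.1 hR
    have hux := unit_sq hx
    have huy := unit_sq hy
    have sx := sub_eq' hx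
    have ax := add_eq' hx
    have sy := sub_eq' hy
    have ay := add_eq' hy
    have hry := rr_nonneg y
    rcases tri y with hy1 | hy1 | hy1
    · obtain ⟨k1, k2, k3, k4, -, -⟩ := gu_R hy1
      obtain ⟨u1, u2⟩ := t_bounds hy1
      rw [h.RR_eq hR hy1]
      have := h.S2_ge hε t1 t2 u1 u2
      rw [g3, k3] at this
      rw [hD]
      linarith
    · obtain ⟨b1, b2, b3⟩ := Lp_bounds hy hy1
      rw [h.RLp_eq hR y0 hy1]
      have := h.DD_sep hε (s := -x 0 / rr x) (α := rr x - x 0) (β := rr x + x 0)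
        (α' := rr y - y 0) (β' := -(rr y + y 0)) (q1 := gu y 0) (qs := rr (gu y))
        (by linarith) (by linarith) (by linarith)
        (by rw [show rr x - x 0 + (rr x + x 0) = 2 * rr x by ring,
              div_eq_div_iff hr.ne' (by positivity)]; ring)
        (by rw [g3]; linarith) (by rw [g3, g4]; linarith) (by linarith) (by linarith)
        (by linarith) (by linarith) (by linarith) b2 b1
      rw [g3, g4] at this
      rw [hD]
      linarith
    · obtain ⟨b1, b2, b3⟩ := Lm_bounds hy hy1
      rw [h.RLm_eq hR y0 hy1]
      have := h.DD_sep hε (s := -(-x 0 / rr x)) (α := rr x + x 0) (β := rr x - x 0)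
        (α' := rr y + y 0) (β' := -(rr y - y 0)) (q1 := -gu y 0) (qs := rr (gu y))
        (by linarith) (by linarith) (by linarith)
        (by rw [show rr x + x 0 + (rr x - x 0) = 2 * rr x by ring, ← neg_div,
              div_eq_div_iff hr.ne' (by positivity)]; ring)
        (by rw [P1_neg, g3]; linarith) (by rw [P1_neg, Ps_neg, g3, g4]; linarith) (by linarith)
        (by linarith)
        (by linarith) (by linarith) (by linarith) b2 b1
      rw [P1_neg, Ps_neg, g3, g4] at this
      rw [hD]
      linarith
  · obtain ⟨a, b⟩ := gu_plus x0 hL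
    rw [h.GG_grad_plus a b, h.GG_Lp x0 hL, inner3]
    simp
    rcases tri y with hy1 | hy1 | hy1
    · obtain ⟨k1, k2, k3, k4, -, -⟩ := gu_R hy1
      obtain ⟨u1, u2⟩ := t_bounds hy1
      have := h.L_R u1 u2
      rw [GG_R hy1]
      rw [k3] at this
      linarith
    · rw [h.GG_Lp y0 hy1]; linarith
    · rw [h.GG_Lm y0 hy1]
      have := mul_nonneg hPh (neg_nonneg.2 (gu_minus y0 hy1).1.le)
      linarith
  · obtain ⟨a, b⟩ := gu_minus x0 hL
    rw [h.GG_grad_minus a b, h.GG_Lm x0 hL, inner3]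
    simp
    rcases tri y with hy1 | hy1 | hy1
    · obtain ⟨k1, k2, k3, k4, -, -⟩ := gu_R hy1
      obtain ⟨u1, u2⟩ := t_bounds hy1
      have := h.L_R (t := -(-y 0 / rr y)) (by linarith) (by linarith)
      rw [GG_R hy1]
      rw [P1_neg, h.FF_neg, k3] at this
      linarith
    · rw [h.GG_Lp y0 hy1]
      have := mul_nonneg hPh (gu_plus y0 hy1).1.le
      linarith
    · rw [h.GG_Lm y0 hy1]; linarith

lemma part_ii {ε η : ℝ} {v : ℝ → ℝ} (h : VP ε η v) (hε : 0 ≤ ε) (hε1 : ε ≤ 1 / 1000) {x y : E3}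
    (hx : ‖x‖ = 1) (hy : ‖y‖ = 1) (hp1 : -(1 / 1600) ≤ gu x 0) (hp2 : gu x 0 ≤ 1 / 1600) :
    1 / 2000 * ‖gu x - gu y‖ ^ 2 ≤
      GG v (gu y) - GG v (gu x) - ⟪gradient (GG v) (gu x), gu y - gu x⟫ := by
  have y0 := unit_ne hy
  have h2 : (1 : ℝ) / 2 ≤ 1 / √2 := by
    apply one_div_le_one_div_of_le sqrt2_pos; linarith [sqrt2_lt]
  rcases tri x with hR | hL | hL
  · have hr : 0 < rr x := (abs_nonneg _).trans_lt hR
    have hrho := rho_nonneg hr (gu y)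
    obtain ⟨t1, t2⟩ := t_bounds hR
    obtain ⟨g1, g2, g3, g4, -, -⟩ := gu_R hR
    have hD := dist_R hR (gu y)
    set s := -x 0 / rr x
    have hs : |s| ≤ 1 / 200 := by
      rw [abs_le]
      constructor
      · rcases le_total 0 s with hs | hs
        · linarith
        · have := P1_diff (s := 0) (t := -s) (by norm_num) (by linarith) (by linarith)
          rw [P1_neg, P1_zero, g3] at this
          linarith
      · rcases le_total 0 s with hs | hs
        · have := P1_diff (s := 0) (t := s) (by norm_num) hs t2
          rw [P1_zero, g3] at this
          linarith
        · linarith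
    have hv : 3 / 4 * rho x (gu y) ≤ v s * rho x (gu y) :=
      mul_le_mul_of_nonneg_right (h.ge s (by linarith)) hrho
    have hrr : rr (gu x) * rho x (gu y) ≤ 1 * rho x (gu y) :=
      mul_le_mul_of_nonneg_right (rr_gu_le hx) hrho
    have p0 := rr_nonneg (gu x)
    have q0 := rr_nonneg (gu y)
    have p1 := rr_gu_le hx
    have q1 := rr_gu_le hy
    have hs2 : (rr (gu y) - rr (gu x)) ^ 2 ≤ 1 := by nlinarith
    have hp : ∀ {z : ℝ}, -1 ≤ z → z ≤ 1 → (z - gu x 0) ^ 2 ≤ 4 := fun h1 h2 => by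
      apply (pow_le_pow_iff_left₀ (abs_nonneg _) (by norm_num) two_ne_zero).2 _ |>.trans'
        (sq_abs _).ge |>.trans (show (2 : ℝ) ^ 2 ≤ 4 by norm_num)
      rw [abs_le]; constructor <;> linarith
    rcases tri y with hy1 | hy1 | hy1
    · obtain ⟨k1, k2, k3, k4, -, -⟩ := gu_R hy1
      obtain ⟨u1, u2⟩ := t_bounds hy1
      rw [h.RR_eq hR hy1]
      have := h.S2_strict hε hε1 hs u1 u2
      rw [g3, k3] at this
      have hd : (rr (gu y) - rr (gu x)) ^ 2 ≤ (gu y 0 - gu x 0) ^ 2 := by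
        rw [sq_le_sq, ← g3, ← g4, ← k3, ← k4]
        rcases le_total s (-y 0 / rr y) with hst | hst
        · exact (Ps_diff t1 hst u2).trans (le_abs_self _)
        · rw [abs_sub_comm, abs_sub_comm (P1 _)]
          exact (Ps_diff u1 hst t2).trans (le_abs_self _)
      rw [hD]
      have := sq_nonneg (gu y 0 - gu x 0)
      linarith
    · obtain ⟨b1, b2, b3⟩ := Lp_bounds hy hy1
      rw [h.RLp_eq hR y0 hy1]
      have := h.DD_strict hε hε1 hs b2 b1 b3
      have := hp (z := gu y 0) (by linarith) b2
      rw [hD]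
      linarith
    · obtain ⟨b1, b2, b3⟩ := Lm_bounds hy hy1
      rw [h.RLm_eq hR y0 hy1]
      have := h.DD_strict hε hε1 (s := -s) (by rwa [abs_neg]) b2 b1 b3
      have := hp (z := gu y 0) (by linarith) (by linarith)
      rw [hD]
      linarith
  · have := (Lp_bounds hx hL).1
    linarith
  · have := (Lm_bounds hx hL).1
    linarith

end VP

/-- Key proposition: for suitable `δ, γ` and any `ε > 0` there is a smooth `G` near `Ω` with
`div(∇G(∇u₀)) = 0` weakly in `B₁ ∖ {0}`, uniform quadratic separation from points of
`Ω_R ∩ {−1+δ ≤ p₁ ≤ 1−δ}`, and separation at worst `−ε|p−q|²` on `Ω`. -/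
theorem statement5 :
    ∃ δ ∈ Set.Ioo (0 : ℝ) 1, ∃ γ > (0 : ℝ), ∀ ε > (0 : ℝ),
      ∃ (U : Set (EuclideanSpace ℝ (Fin 3))) (G : EuclideanSpace ℝ (Fin 3) → ℝ),
        IsOpen U ∧ Om ⊆ U ∧ ContDiffOn ℝ (⊤ : ℕ∞) G U ∧
        (∀ ψ : EuclideanSpace ℝ (Fin 3) → ℝ, ContDiff ℝ (⊤ : ℕ∞) ψ → HasCompactSupport ψ →
          tsupport ψ ⊆ ball (0 : EuclideanSpace ℝ (Fin 3)) 1 \ {0} →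
          ∫ x in ball (0 : EuclideanSpace ℝ (Fin 3)) 1,
            ⟪gradient G (gradient u0 x), gradient ψ x⟫ = 0) ∧
        (∀ p ∈ OmR, -1 + δ ≤ p 0 → p 0 ≤ 1 - δ → ∀ q ∈ Om,
          γ * ‖p - q‖ ^ 2 ≤ G q - G p - ⟪gradient G p, q - p⟫) ∧
        (∀ p ∈ Om, ∀ q ∈ Om,
          -ε * ‖p - q‖ ^ 2 ≤ G q - G p - ⟪gradient G p, q - p⟫) := by
  refine ⟨1 - 1 / 1600, ⟨by norm_num, by norm_num⟩, 1 / 2000, by norm_num, fun ε hε => ?_⟩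
  have h0 : 0 < min (ε / 100000) (1 / 1000) := lt_min (by positivity) (by norm_num)
  have h1 : min (ε / 100000) (1 / 1000) ≤ 1 / 1000 := min_le_right _ _
  have h2 : min (ε / 100000) (1 / 1000) ≤ ε / 100000 := min_le_left _ _
  set e := min (ε / 100000) (1 / 1000)
  obtain ⟨η, v, h⟩ := exists_VP h0 (by linarith)
  refine ⟨{0}ᶜ, GG v, isOpen_compl_singleton, ?_, ?_, ?_, ?_, ?_⟩
  · rintro p ⟨x, hx, rfl⟩
    rw [gradient_u0 (unit_ne hx)]
    exact gu_ne_zero (unit_ne hx)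
  · intro p hp
    exact (h.GG_contDiffAt hp).contDiffWithinAt
  · intro ψ hψ hc hs
    exact h.part_i ψ hψ hc hs
  · rintro p ⟨x, hx, -, rfl⟩ hp1 hp2 q ⟨y, hy, rfl⟩
    rw [gradient_u0 (unit_ne hx)] at *
    rw [gradient_u0 (unit_ne hy)]
    exact h.part_ii h0.le h1 hx hy (by linarith) (by linarith)
  · rintro p ⟨x, hx, rfl⟩ q ⟨y, hy, rfl⟩
    rw [gradient_u0 (unit_ne hx), gradient_u0 (unit_ne hy)]
    refine le_trans ?_ (h.part_iii h0.le hx hy)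
    have : 100000 * e ≤ ε := by linarith
    have := mul_le_mul_of_nonneg_right this (sq_nonneg ‖gu x - gu y‖)
    linarith
end
end

section
/- Define a(x) = −2x − φ(x) for x ∈ [−1,1]. Then a is uniformly concave on (−1,1) (a''(x) ≤ −c for some c > 0), a(−1) = 1 with a'(x) → −1 as x ↓ −1 (tangency to Γ₂ at the cusp (−1,1)), and for every t ∈ (−1,1) one has t < a(−φ(t)); i.e., the graph of a lies strictly above the curve Γ₂ = {(−φ(t), t) : t ∈ [−1,1]} except at the cusp (−1,1). -/
open Real Set Metric Filter
open scoped RealInnerProductSpace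

noncomputable section

/-- `w(x₁,x₂) = (x₂² − x₁²)/√(2(x₁²+x₂²))` (with value `0` at the origin, by `0`-division). -/
def w2 : EuclideanSpace ℝ (Fin 2) → ℝ :=
  fun x => ((x 1) ^ 2 - (x 0) ^ 2) / Real.sqrt (2 * ((x 0) ^ 2 + (x 1) ^ 2))

/-- `Γ = ∇w(S¹)`. -/
def Ga : Set (EuclideanSpace ℝ (Fin 2)) :=
  {p | ∃ x : EuclideanSpace ℝ (Fin 2), ‖x‖ = 1 ∧ gradient w2 x = p}

/-- `Γ₁ = Γ ∩ {p₂ ≥ |p₁|}`. -/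
def Ga1 : Set (EuclideanSpace ℝ (Fin 2)) :=
  Ga ∩ {p | |p 0| ≤ p 1}

lemma grad_w2 (a b : ℝ) (h : a ^ 2 + b ^ 2 = 1) :
    gradient w2 !₂[a, b] = !₂[-a * (2 + b ^ 2 - a ^ 2) / √2, b * (2 - b ^ 2 + a ^ 2) / √2] := by
  apply HasGradientAt.gradient
  rw [hasGradientAt_iff_hasFDerivAt]
  have h0 : HasFDerivAt (fun x : EuclideanSpace ℝ (Fin 2) => x 0)
      (EuclideanSpace.proj 0 : EuclideanSpace ℝ (Fin 2) →L[ℝ] ℝ) !₂[a, b] :=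
    (EuclideanSpace.proj 0 : EuclideanSpace ℝ (Fin 2) →L[ℝ] ℝ).hasFDerivAt
  have h1 : HasFDerivAt (fun x : EuclideanSpace ℝ (Fin 2) => x 1)
      (EuclideanSpace.proj 1 : EuclideanSpace ℝ (Fin 2) →L[ℝ] ℝ) !₂[a, b] :=
    (EuclideanSpace.proj 1 : EuclideanSpace ℝ (Fin 2) →L[ℝ] ℝ).hasFDerivAt
  have hs : √(2 * (a ^ 2 + b ^ 2)) = √2 := by rw [h, mul_one]
  have h2 : √2 ≠ 0 := by positivity
  have h22 : √2 ^ 2 = 2 := Real.sq_sqrt (by norm_num)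
  have hS := (((h0.pow 2).add (h1.pow 2)).const_mul 2).sqrt (by simp [h])
  have hD := ((h1.pow 2).sub (h0.pow 2)).mul
    ((hasDerivAt_inv (by simp [h])).comp_hasFDerivAt _ hS)
  refine HasFDerivAt.congr_fderiv (f := w2) hD ?_
  ext v
  simp [PiLp.inner_apply, Fin.sum_univ_two, h]
  field_simp
  ring

lemma phi_param (φ : ℝ → ℝ)
    (hφgraph : Ga1 = {p : EuclideanSpace ℝ (Fin 2) | p 0 ∈ Set.Icc (-1 : ℝ) 1 ∧ p 1 = φ (p 0)})
    (p q : ℝ) (hp : 0 ≤ p) (hq : 0 ≤ q) (h : p ^ 2 + q ^ 2 = 1) :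
    φ (p ^ 3 - q ^ 3) = p ^ 3 + q ^ 3 := by
  have h2 : √2 ≠ 0 := by positivity
  have h22 : √2 ^ 2 = 2 := Real.sq_sqrt (by norm_num)
  have h24 : √2 ^ 4 = 4 := by rw [show (4 : ℕ) = 2 * 2 from rfl, pow_mul, h22]; norm_num
  have hab : ((q - p) / √2) ^ 2 + ((p + q) / √2) ^ 2 = 1 := by
    rw [div_pow, div_pow, h22]; linarith
  have hg := grad_w2 _ _ hab
  have e0 : -((q - p) / √2) * (2 + ((p + q) / √2) ^ 2 - ((q - p) / √2) ^ 2) / √2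
      = p ^ 3 - q ^ 3 := by
    field_simp
    simp only [h22, h24]
    linear_combination (4 * (q - p)) * h
  have e1 : ((p + q) / √2) * (2 - ((p + q) / √2) ^ 2 + ((q - p) / √2) ^ 2) / √2
      = p ^ 3 + q ^ 3 := by
    field_simp
    simp only [h22, h24]
    linear_combination (-4 * (q + p)) * h
  rw [e0, e1] at hg
  have hm : (!₂[p ^ 3 - q ^ 3, p ^ 3 + q ^ 3] : EuclideanSpace ℝ (Fin 2)) ∈ Ga1 := by
    refine ⟨⟨_, ?_, hg⟩, ?_⟩
    · rw [EuclideanSpace.norm_eq, Real.sqrt_eq_one]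
      simpa [Fin.sum_univ_two] using hab
    · have : 0 ≤ p ^ 3 := by positivity
      have : 0 ≤ q ^ 3 := by positivity
      simp only [mem_ofPred_eq, abs_le]
      simp
      constructor <;> linarith
  rw [hφgraph] at hm
  have := hm.2
  simpa using this.symm

lemma param_surj (x : ℝ) (hx : x ∈ Set.Ioo (-1 : ℝ) 1) :
    ∃ α ∈ Set.Ioo 0 (π / 2), sin α ^ 3 - cos α ^ 3 = x := by
  have := intermediate_value_Ioo (f := fun α : ℝ => sin α ^ 3 - cos α ^ 3)
    (a := 0) (b := π / 2) (by positivity) (by fun_prop)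
  have h2 := this (a := x) (by simpa using hx)
  exact h2

lemma X_mem (α : ℝ) (hs : 0 < sin α) (hc : 0 < cos α) :
    sin α ^ 3 - cos α ^ 3 ∈ Set.Ioo (-1 : ℝ) 1 ∧ sin α ^ 3 + cos α ^ 3 < 1 := by
  have h := sin_sq_add_cos_sq α
  have hs1 : sin α < 1 := by nlinarith
  have hc1 : cos α < 1 := by nlinarith
  have : 0 < sin α ^ 3 := by positivity
  have : 0 < cos α ^ 3 := by positivity
  have : 0 < sin α ^ 2 * (1 - sin α) := mul_pos (by positivity) (by linarith)
  have : 0 < cos α ^ 2 * (1 - cos α) := mul_pos (by positivity) (by linarith)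
  refine ⟨⟨?_, ?_⟩, ?_⟩ <;> nlinarith

lemma X_deriv (α : ℝ) : HasDerivAt (fun α : ℝ => sin α ^ 3 - cos α ^ 3)
    (3 * sin α * cos α * (sin α + cos α)) α := by
  have := ((hasDerivAt_sin α).fun_pow 3).fun_sub ((hasDerivAt_cos α).fun_pow 3)
  refine this.congr_deriv ?_
  norm_num; ring

lemma Y_deriv (α : ℝ) : HasDerivAt (fun α : ℝ => sin α ^ 3 + cos α ^ 3)
    (3 * sin α * cos α * (sin α - cos α)) α := by
  have := ((hasDerivAt_sin α).fun_pow 3).fun_add ((hasDerivAt_cos α).fun_pow 3)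
  refine this.congr_deriv ?_
  norm_num; ring

lemma sc_pos {α : ℝ} (h : α ∈ Set.Ioo 0 (π / 2)) : 0 < sin α ∧ 0 < cos α :=
  ⟨sin_pos_of_pos_of_lt_pi h.1 (by linarith [h.2, pi_pos]),
    cos_pos_of_mem_Ioo ⟨by linarith [h.1, pi_pos], h.2⟩⟩

lemma phi_deriv (φ : ℝ → ℝ)
    (hP : ∀ p q : ℝ, 0 ≤ p → 0 ≤ q → p ^ 2 + q ^ 2 = 1 → φ (p ^ 3 - q ^ 3) = p ^ 3 + q ^ 3)
    (hφs : ContDiffOn ℝ (⊤ : ℕ∞) φ (Set.Ioo (-1) 1))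
    (α : ℝ) (hα : α ∈ Set.Ioo 0 (π / 2)) :
    deriv φ (sin α ^ 3 - cos α ^ 3) = (sin α - cos α) / (sin α + cos α) := by
  obtain ⟨hs, hc⟩ := sc_pos hα
  have hX := (X_mem α hs hc).1
  have hd : DifferentiableAt ℝ φ (sin α ^ 3 - cos α ^ 3) :=
    (hφs.differentiableOn (by simp)).differentiableAt (isOpen_Ioo.mem_nhds hX)
  have h1 := HasDerivAt.comp α hd.hasDerivAt (X_deriv α)
  have h2 : (φ ∘ fun α : ℝ => sin α ^ 3 - cos α ^ 3) =ᶠ[nhds α]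
      (fun α : ℝ => sin α ^ 3 + cos α ^ 3) := by
    filter_upwards [isOpen_Ioo.mem_nhds hα] with β hβ
    obtain ⟨hs, hc⟩ := sc_pos hβ
    exact hP _ _ hs.le hc.le (sin_sq_add_cos_sq β)
  have h3 := h1.unique ((Y_deriv α).congr_of_eventuallyEq h2)
  have : 3 * sin α * cos α ≠ 0 := by positivity
  rw [eq_div_iff (by positivity)]
  apply mul_left_cancel₀ this
  linarith

lemma phi_deriv2 (φ : ℝ → ℝ)
    (hP : ∀ p q : ℝ, 0 ≤ p → 0 ≤ q → p ^ 2 + q ^ 2 = 1 → φ (p ^ 3 - q ^ 3) = p ^ 3 + q ^ 3)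
    (hφs : ContDiffOn ℝ (⊤ : ℕ∞) φ (Set.Ioo (-1) 1))
    (α : ℝ) (hα : α ∈ Set.Ioo 0 (π / 2)) :
    1 / 12 ≤ deriv (deriv φ) (sin α ^ 3 - cos α ^ 3) := by
  obtain ⟨hs, hc⟩ := sc_pos hα
  have hX := (X_mem α hs hc).1
  have hd : DifferentiableAt ℝ (deriv φ) (sin α ^ 3 - cos α ^ 3) :=
    ((hφs.deriv_of_isOpen (m := 1) isOpen_Ioo (by
      rw [one_add_one_eq_two]; exact WithTop.coe_le_coe.2 (le_top : (2 : ℕ∞) ≤ ⊤))).differentiableOn (by simp)).differentiableAt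
        (isOpen_Ioo.mem_nhds hX)
  have h1 := HasDerivAt.comp α hd.hasDerivAt (X_deriv α)
  have h2 : (deriv φ ∘ fun α : ℝ => sin α ^ 3 - cos α ^ 3) =ᶠ[nhds α]
      (fun α : ℝ => (sin α - cos α) / (sin α + cos α)) := by
    filter_upwards [isOpen_Ioo.mem_nhds hα] with β hβ
    exact phi_deriv φ hP hφs β hβ
  have hQ := ((hasDerivAt_sin α).fun_sub (hasDerivAt_cos α)).fun_div
    ((hasDerivAt_sin α).fun_add (hasDerivAt_cos α)) (by positivity)
  have h3 := h1.unique (hQ.congr_of_eventuallyEq h2)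
  have h := sin_sq_add_cos_sq α
  have hs1 := sin_le_one α
  have hc1 := cos_le_one α
  rw [eq_div_iff (by positivity)] at h3
  set D := deriv (deriv φ) (sin α ^ 3 - cos α ^ 3)
  have h4 : D * (3 * (sin α * cos α) * (sin α + cos α) ^ 3) = 2 := by
    linear_combination h3 + 2 * h
  have h5 : 3 * (sin α * cos α) * (sin α + cos α) ^ 3 ≤ 3 * (1 * 1) * (1 + 1) ^ 3 := by
    gcongr
  have h6 : 0 < 3 * (sin α * cos α) * (sin α + cos α) ^ 3 := by positivity
  have h7 : 0 < D := by
    by_contra hn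
    nlinarith
  nlinarith

/-- `a(x) = −2x − φ(x)` is uniformly concave, tangent to `Γ₂` at the cusp `(−1,1)`
(`a(−1) = 1`, `a' → −1` as `x ↓ −1`), and its graph lies strictly above
`Γ₂ = {(−φ(t), t)}` for `t ∈ (−1,1)`. -/
theorem statement9 (φ : ℝ → ℝ)
    (hφc : ContinuousOn φ (Set.Icc (-1) 1))
    (hφgraph : Ga1 = {p : EuclideanSpace ℝ (Fin 2) | p 0 ∈ Set.Icc (-1 : ℝ) 1 ∧ p 1 = φ (p 0)})
    (hφs : ContDiffOn ℝ (⊤ : ℕ∞) φ (Set.Ioo (-1) 1)) :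
    (∃ c > (0 : ℝ), ∀ x ∈ Set.Ioo (-1 : ℝ) 1,
      iteratedDeriv 2 (fun y => -2 * y - φ y) x ≤ -c) ∧
    (-2 * (-1 : ℝ) - φ (-1) = 1) ∧
    Filter.Tendsto (deriv (fun y => -2 * y - φ y))
      (nhdsWithin (-1) (Set.Ioi (-1))) (nhds (-1)) ∧
    (∀ t ∈ Set.Ioo (-1 : ℝ) 1, t < -2 * (-(φ t)) - φ (-(φ t))) := by
  have hP := phi_param φ hφgraph
  have hD1 := phi_deriv φ hP hφs
  have hdiff : ∀ x ∈ Set.Ioo (-1 : ℝ) 1, DifferentiableAt ℝ φ x := fun x hx =>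
    (hφs.differentiableOn (by simp)).differentiableAt (isOpen_Ioo.mem_nhds hx)
  have hda : ∀ x ∈ Set.Ioo (-1 : ℝ) 1,
      deriv (fun y => -2 * y - φ y) x = -2 - deriv φ x := by
    intro x hx
    have := ((hasDerivAt_id x).const_mul (-2)).fun_sub (hdiff x hx).hasDerivAt
    simpa using this.deriv
  refine ⟨⟨1 / 12, by norm_num, ?_⟩, ?_, ?_, ?_⟩
  · intro x hx
    obtain ⟨α, hα, rfl⟩ := param_surj x hx
    have h2 := phi_deriv2 φ hP hφs α hα
    rw [iteratedDeriv_succ, iteratedDeriv_one]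
    have : deriv (fun y => -2 * y - φ y) =ᶠ[nhds (sin α ^ 3 - cos α ^ 3)]
        fun x => -2 - deriv φ x := by
      filter_upwards [isOpen_Ioo.mem_nhds hx] with y hy using hda y hy
    rw [this.deriv_eq, deriv_const_sub]
    linarith
  · have := hP 0 1 (by norm_num) (by norm_num) (by norm_num)
    norm_num at this
    rw [this]; norm_num
  · have hev : ∀ᶠ x in nhdsWithin (-1 : ℝ) (Set.Ioi (-1)), x ∈ Set.Ioo (-1 : ℝ) 1 :=
      Ioo_mem_nhdsGT (by norm_num)
    have hb : ∀ x ∈ Set.Ioo (-1 : ℝ) 1,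
        -1 - 2 * (x + 1) ^ (1 / 3 : ℝ) ≤ deriv (fun y => -2 * y - φ y) x ∧
        deriv (fun y => -2 * y - φ y) x ≤ -1 := by
      intro x hx
      rw [hda x hx]
      obtain ⟨α, hα, rfl⟩ := param_surj x hx
      obtain ⟨hs, hc⟩ := sc_pos hα
      rw [hD1 α hα]
      have h := sin_sq_add_cos_sq α
      have hc1 := cos_le_one α
      have e : -2 - (sin α - cos α) / (sin α + cos α)
          = -1 - 2 * (sin α / (sin α + cos α)) := by
        field_simp; ring
      have h1 : sin α / (sin α + cos α) ≤ sin α := by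
        apply div_le_self hs.le
        nlinarith
      have h0 : 0 ≤ sin α / (sin α + cos α) := by positivity
      have hc3 : cos α ^ 3 ≤ 1 := pow_le_one₀ hc.le hc1
      have h3 : sin α ≤ (sin α ^ 3 - cos α ^ 3 + 1) ^ (1 / 3 : ℝ) := by
        calc sin α = (sin α ^ 3) ^ (1 / 3 : ℝ) := by
              rw [← Real.rpow_natCast, ← Real.rpow_mul hs.le]; norm_num
          _ ≤ _ := by
              apply Real.rpow_le_rpow (by positivity) (by linarith) (by norm_num)
      rw [e]
      constructor <;> linarith
    refine tendsto_of_tendsto_of_tendsto_of_le_of_le' (g := fun x : ℝ => -1 - 2 * (x + 1) ^ (1 / 3 : ℝ))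
      (h := fun _ => -1) ?_ tendsto_const_nhds
      (hev.mono fun x hx => (hb x hx).1) (hev.mono fun x hx => (hb x hx).2)
    have hcont : Continuous (fun x : ℝ => -1 - 2 * (x + 1) ^ (1 / 3 : ℝ)) := by
      have : Continuous (fun x : ℝ => (x + 1) ^ (1 / 3 : ℝ)) :=
        (by fun_prop : Continuous fun x : ℝ => x + 1).rpow_const (fun _ => Or.inr (by norm_num))
      fun_prop
    have := (hcont.tendsto (-1)).mono_left (nhdsWithin_le_nhds (s := Set.Ioi (-1)))
    norm_num at this ⊢
    exact this
  · have hanti : StrictAntiOn (fun x => φ x - x) (Set.Ioo (-1 : ℝ) 1) := by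
      apply strictAntiOn_of_deriv_neg (convex_Ioo _ _)
      · exact hφs.continuousOn.sub continuousOn_id
      · rw [interior_Ioo]
        intro x hx
        have := ((hdiff x hx).hasDerivAt.fun_sub (hasDerivAt_id' x)).deriv
        rw [this]
        obtain ⟨α, hα, rfl⟩ := param_surj x hx
        obtain ⟨hs, hc⟩ := sc_pos hα
        rw [hD1 α hα, sub_neg, div_lt_one (by positivity)]
        linarith
    have heven : ∀ x ∈ Set.Ioo (-1 : ℝ) 1, φ (-x) = φ x := by
      intro x hx
      obtain ⟨α, hα, rfl⟩ := param_surj x hx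
      obtain ⟨hs, hc⟩ := sc_pos hα
      have h := sin_sq_add_cos_sq α
      rw [hP _ _ hs.le hc.le h, neg_sub, hP _ _ hc.le hs.le (by linarith)]
      ring
    intro t ht
    have key : t < φ t ∧ φ t ∈ Set.Ioo (-1 : ℝ) 1 := by
      obtain ⟨α, hα, rfl⟩ := param_surj t ht
      obtain ⟨hs, hc⟩ := sc_pos hα
      have h := sin_sq_add_cos_sq α
      rw [hP _ _ hs.le hc.le h]
      have h1 : 0 < sin α ^ 3 := by positivity
      have h2 : 0 < cos α ^ 3 := by positivity
      exact ⟨by linarith, by linarith, (X_mem α hs hc).2⟩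
    have := hanti ht key.2 key.1
    simp only at this
    rw [heven _ key.2]
    linarith
end
end

section
/- Let f : (−1,1) → ℝ be smooth, set h = f''/(2φ'') on (−1,1), and define G(p₁,p₂,p₃) = f(p₁) + h(p₁)(√(p₂²+p₃²) − φ(p₁)) for |p₁| < 1 and (p₂,p₃) ≠ (0,0). Then the vector field V(x) = ∇G(∇u₀(x)) is well defined and smooth on the open cone O = {x ∈ ℝ³ : x₁² < x₂² + x₃²}, and div V = 0 at every point of O. -/
open Real Set Metric Filter
open scoped RealInnerProductSpace

noncomputable section

/-- The open cone `O = {x₁² < x₂² + x₃²}`. -/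
def coneO : Set (EuclideanSpace ℝ (Fin 3)) :=
  {x | (x 0) ^ 2 < (x 1) ^ 2 + (x 2) ^ 2}

/-- Move the `i`-th coordinate of `x` to `t`. -/
def slideC {n : ℕ} (x : EuclideanSpace ℝ (Fin n)) (i : Fin n) (t : ℝ) : EuclideanSpace ℝ (Fin n) :=
  x + (t - x i) • EuclideanSpace.single i (1 : ℝ)

lemma slideC_self {n : ℕ} (x : EuclideanSpace ℝ (Fin n)) (i : Fin n) : slideC x i (x i) = x := by
  simp [slideC]

lemma slideC_same {n : ℕ} (x : EuclideanSpace ℝ (Fin n)) (i : Fin n) (t : ℝ) :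
    slideC x i t i = t := by
  simp [slideC]

lemma slideC_ne {n : ℕ} (x : EuclideanSpace ℝ (Fin n)) {i j : Fin n} (hij : j ≠ i) (t : ℝ) :
    slideC x i t j = x j := by
  simp [slideC, hij]

lemma slideC_deriv {n : ℕ} (x : EuclideanSpace ℝ (Fin n)) (i : Fin n) (t : ℝ) :
    HasDerivAt (slideC x i) (EuclideanSpace.single i (1 : ℝ)) t := by
  have h1 : HasDerivAt (fun t : ℝ => t - x i) 1 t := (hasDerivAt_id t).sub_const _
  have h2 := (h1.smul_const (EuclideanSpace.single i (1 : ℝ))).const_add x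
  rw [one_smul] at h2
  exact h2

lemma fderiv_slide {n : ℕ} {F : Type*} [NormedAddCommGroup F] [NormedSpace ℝ F]
    {H : EuclideanSpace ℝ (Fin n) → F} {x : EuclideanSpace ℝ (Fin n)}
    (hH : DifferentiableAt ℝ H x) (i : Fin n) :
    HasDerivAt (fun t => H (slideC x i t)) (fderiv ℝ H x (EuclideanSpace.single i 1)) (x i) := by
  have h1 : HasFDerivAt H (fderiv ℝ H x) (slideC x i (x i)) := by
    rw [slideC_self]; exact hH.hasFDerivAt
  exact h1.comp_hasDerivAt (x i) (slideC_deriv x i (x i))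

lemma grad_coord {n : ℕ} {H : EuclideanSpace ℝ (Fin n) → ℝ} {x : EuclideanSpace ℝ (Fin n)}
    (hH : DifferentiableAt ℝ H x) (i : Fin n) {g : ℝ}
    (hg : HasDerivAt (fun t => H (slideC x i t)) g (x i)) :
    gradient H x i = g := by
  have h1 := (fderiv_slide hH i).unique hg
  rw [← h1]
  have h2 := hH.hasGradientAt.hasFDerivAt.fderiv
  rw [h2, InnerProductSpace.toDual_apply_apply]
  generalize gradient H x = v
  simp [EuclideanSpace.inner_single_right]

/-- First coordinate of the gradient, in terms of `x` and `R = ρ²`. -/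
def aa (x R : ℝ) : ℝ := -x * (x ^ 2 + 3 * R) / (√2 * √(x ^ 2 + R) ^ 3)

/-- Second coordinate of the gradient divided by `ρ`. -/
def bb (x R : ℝ) : ℝ := (3 * x ^ 2 + R) / (√2 * √(x ^ 2 + R) ^ 3)

lemma aa_lt {x R : ℝ} (h : x ^ 2 < R) : aa x R ∈ Ioo (-1 : ℝ) 1 := by
  have hx := sq_nonneg x
  have hp : 0 < x ^ 2 + R := by linarith
  have h2 : √2 ^ 2 = (2 : ℝ) := sq_sqrt (by norm_num)
  have hs : √(x ^ 2 + R) ^ 2 = x ^ 2 + R := sq_sqrt hp.le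
  have hs0 : 0 < √(x ^ 2 + R) := sqrt_pos.2 hp
  have h20 : 0 < √(2 : ℝ) := sqrt_pos.2 (by norm_num)
  have key : aa x R ^ 2 < 1 := by
    have h6 : (√2 * √(x ^ 2 + R) ^ 3) ^ 2 = 2 * (x ^ 2 + R) ^ 3 := by
      calc (√2 * √(x ^ 2 + R) ^ 3) ^ 2 = √2 ^ 2 * (√(x ^ 2 + R) ^ 2) ^ 3 := by ring
        _ = _ := by rw [h2, hs]
    unfold aa
    rw [div_pow, h6, div_lt_one (by positivity)]
    have h3 : 0 < (x ^ 2 - R) ^ 2 * (x ^ 2 + 2 * R) := by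
      apply mul_pos
      · apply sq_pos_of_neg; linarith
      · linarith
    nlinarith
  exact abs_lt.1 ((sq_lt_one_iff_abs_lt_one _).1 key)

lemma sqrt_add_deriv {x R : ℝ} (hp : 0 < x ^ 2 + R) :
    HasDerivAt (fun t : ℝ => √(t ^ 2 + R)) (x / √(x ^ 2 + R)) x := by
  have h1 : HasDerivAt (fun t : ℝ => t ^ 2 + R) (2 * x) x := by
    simpa using ((hasDerivAt_id x).pow 2).add_const R
  convert h1.sqrt hp.ne' using 1
  have hs0 : 0 < √(x ^ 2 + R) := sqrt_pos.2 hp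
  field_simp

lemma aa_deriv {x R : ℝ} (hp : 0 < x ^ 2 + R) :
    HasDerivAt (fun t => aa t R) (3 * R * (x ^ 2 - R) / (√2 * √(x ^ 2 + R) ^ 5)) x := by
  have hs : √(x ^ 2 + R) ^ 2 = x ^ 2 + R := sq_sqrt hp.le
  have hs0 : 0 < √(x ^ 2 + R) := sqrt_pos.2 hp
  have h20 : 0 < √(2 : ℝ) := sqrt_pos.2 (by norm_num)
  have h1 := (hasDerivAt_id x).neg.mul ((((hasDerivAt_id x).pow 2)).add_const (3 * R))
  have h2 := ((sqrt_add_deriv hp).pow 3).const_mul (√2)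
  have h3 := h1.div h2 (by simp only [Pi.pow_apply]; positivity)
  have hR : R = √(x ^ 2 + R) ^ 2 - x ^ 2 := by linarith
  refine h3.congr_deriv ?_
  simp only [id, Pi.neg_apply, Pi.mul_apply, Pi.pow_apply]
  generalize √(x ^ 2 + R) = s at *
  subst hR
  field_simp
  norm_num
  ring

lemma bb_deriv {x R : ℝ} (hp : 0 < x ^ 2 + R) :
    HasDerivAt (fun t => bb t R) (-3 * x * (x ^ 2 - R) / (√2 * √(x ^ 2 + R) ^ 5)) x := by
  have hs : √(x ^ 2 + R) ^ 2 = x ^ 2 + R := sq_sqrt hp.le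
  have hs0 : 0 < √(x ^ 2 + R) := sqrt_pos.2 hp
  have h20 : 0 < √(2 : ℝ) := sqrt_pos.2 (by norm_num)
  have h1 := (((hasDerivAt_id x).pow 2).const_mul 3).add_const R
  have h2 := ((sqrt_add_deriv hp).pow 3).const_mul (√2)
  have h3 := h1.div h2 (by simp only [Pi.pow_apply]; positivity)
  have hR : R = √(x ^ 2 + R) ^ 2 - x ^ 2 := by linarith
  refine h3.congr_deriv ?_
  simp only [id, Pi.neg_apply, Pi.mul_apply, Pi.pow_apply]
  generalize √(x ^ 2 + R) = s at *
  subst hR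
  field_simp
  norm_num
  ring

/-- Derivative of `aa` in the second variable. -/
lemma aa_deriv2 {x R : ℝ} (hp : 0 < x ^ 2 + R) :
    HasDerivAt (fun S => aa x S) (-3 * x * (x ^ 2 - R) / (2 * √2 * √(x ^ 2 + R) ^ 5)) R := by
  have hs : √(x ^ 2 + R) ^ 2 = x ^ 2 + R := sq_sqrt hp.le
  have hs0 : 0 < √(x ^ 2 + R) := sqrt_pos.2 hp
  have h20 : 0 < √(2 : ℝ) := sqrt_pos.2 (by norm_num)
  have h1 := ((((hasDerivAt_id R).const_mul 3).const_add (x ^ 2))).const_mul (-x)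
  have h2 := (((((hasDerivAt_id R).const_add (x ^ 2)).sqrt hp.ne').pow 3)).const_mul (√2)
  have h3 := h1.div h2 (by simp only [id, Pi.pow_apply]; positivity)
  have hR : R = √(x ^ 2 + R) ^ 2 - x ^ 2 := by linarith
  refine h3.congr_deriv ?_
  simp only [id, Pi.neg_apply, Pi.mul_apply, Pi.pow_apply]
  generalize √(x ^ 2 + R) = s at *
  subst hR
  field_simp
  norm_num
  ring

/-- The 1D derivative of `(R - t²)/(√2 √(t²+R))` in `t`. -/
lemma u_deriv0 {x R : ℝ} (hp : 0 < x ^ 2 + R) :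
    HasDerivAt (fun t => (R - t ^ 2) / (√2 * √(t ^ 2 + R))) (aa x R) x := by
  have hs : √(x ^ 2 + R) ^ 2 = x ^ 2 + R := sq_sqrt hp.le
  have hs0 : 0 < √(x ^ 2 + R) := sqrt_pos.2 hp
  have h20 : 0 < √(2 : ℝ) := sqrt_pos.2 (by norm_num)
  have h1 := ((hasDerivAt_id x).pow 2).const_sub R
  have h2 := (sqrt_add_deriv hp).const_mul (√2)
  have h3 := h1.div h2 (by positivity)
  have hR : R = √(x ^ 2 + R) ^ 2 - x ^ 2 := by linarith
  refine h3.congr_deriv ?_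
  unfold aa
  simp only [id, Pi.neg_apply, Pi.mul_apply, Pi.pow_apply]
  generalize √(x ^ 2 + R) = s at *
  subst hR
  field_simp
  norm_num
  ring

/-- The 1D derivative of the potential in a transversal variable. -/
lemma u_deriv1 {x y c : ℝ} (hp : 0 < x ^ 2 + (y ^ 2 + c)) :
    HasDerivAt (fun t => ((t ^ 2 + c) - x ^ 2) / (√2 * √(x ^ 2 + (t ^ 2 + c))))
      (y * bb x (y ^ 2 + c)) y := by
  have hs : √(x ^ 2 + (y ^ 2 + c)) ^ 2 = x ^ 2 + (y ^ 2 + c) := sq_sqrt hp.le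
  have hs0 : 0 < √(x ^ 2 + (y ^ 2 + c)) := sqrt_pos.2 hp
  have h20 : 0 < √(2 : ℝ) := sqrt_pos.2 (by norm_num)
  have h0 := ((hasDerivAt_id y).pow 2).add_const c
  have h1 := h0.sub_const (x ^ 2)
  have h2 := ((h0.const_add (x ^ 2)).sqrt hp.ne').const_mul (√2)
  have h3 := h1.div h2 (by simp only [id, Pi.pow_apply]; positivity)
  have hR : c = √(x ^ 2 + (y ^ 2 + c)) ^ 2 - x ^ 2 - y ^ 2 := by linarith
  refine h3.congr_deriv ?_
  unfold bb
  simp only [id, Pi.neg_apply, Pi.mul_apply, Pi.pow_apply]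
  generalize √(x ^ 2 + (y ^ 2 + c)) = s at *
  subst hR
  field_simp
  norm_num
  ring

lemma grad_w2_s10 {c s : ℝ} (hp : 0 < c ^ 2 + s ^ 2) :
    gradient w2 !₂[c, s] = !₂[aa c (s ^ 2), s * bb c (s ^ 2)] := by
  have hw : ∀ x, w2 x = ((x 1) ^ 2 - (x 0) ^ 2) / (√2 * √((x 0) ^ 2 + (x 1) ^ 2)) := by
    intro x; unfold w2; rw [Real.sqrt_mul (by norm_num)]
  have hd : DifferentiableAt ℝ w2 !₂[c, s] := by
    have : w2 = fun x => ((x 1) ^ 2 - (x 0) ^ 2) / (√2 * √((x 0) ^ 2 + (x 1) ^ 2)) := funext hw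
    rw [this]
    have h20 : 0 < √(2 : ℝ) := sqrt_pos.2 (by norm_num)
    simp only [div_eq_mul_inv]
    refine DifferentiableAt.fun_mul (by fun_prop) (DifferentiableAt.fun_inv ?_ ?_)
    · refine DifferentiableAt.const_mul (DifferentiableAt.sqrt (by fun_prop) ?_) _
      simpa using hp.ne'
    · have : 0 < √(c ^ 2 + s ^ 2) := sqrt_pos.2 hp
      simp [this.ne']
  ext i
  fin_cases i
  · apply grad_coord hd
    have := u_deriv0 (x := c) (R := s ^ 2) hp
    simpa [hw, slideC_same, slideC_ne] using this
  · apply grad_coord hd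
    have := u_deriv1 (x := c) (y := s) (c := 0) (by simpa using hp)
    simpa [hw, slideC_same, slideC_ne] using this

lemma cone_norm (x : EuclideanSpace ℝ (Fin 3)) :
    ‖x‖ = √((x 0) ^ 2 + ((x 1) ^ 2 + (x 2) ^ 2)) := by
  rw [EuclideanSpace.norm_eq]
  simp [Fin.sum_univ_three, add_assoc]

lemma grad_u0 {x : EuclideanSpace ℝ (Fin 3)} (hx : x ∈ coneO) :
    gradient u0 x = !₂[aa (x 0) (x 1 ^ 2 + x 2 ^ 2), x 1 * bb (x 0) (x 1 ^ 2 + x 2 ^ 2),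
      x 2 * bb (x 0) (x 1 ^ 2 + x 2 ^ 2)] := by
  have hx' : (x 0) ^ 2 < (x 1) ^ 2 + (x 2) ^ 2 := hx
  have hp : 0 < (x 0) ^ 2 + ((x 1) ^ 2 + (x 2) ^ 2) := by nlinarith [sq_nonneg (x 0)]
  have hw : ∀ x, u0 x = ((x 1) ^ 2 + (x 2) ^ 2 - (x 0) ^ 2) /
      (√2 * √((x 0) ^ 2 + ((x 1) ^ 2 + (x 2) ^ 2))) := by
    intro x; unfold u0; rw [cone_norm]
  have hd : DifferentiableAt ℝ u0 x := by
    rw [show u0 = _ from funext hw]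
    have h20 : 0 < √(2 : ℝ) := sqrt_pos.2 (by norm_num)
    have := sqrt_pos.2 hp
    simp only [div_eq_mul_inv]
    refine DifferentiableAt.fun_mul (by fun_prop) (DifferentiableAt.fun_inv ?_ (by positivity))
    refine DifferentiableAt.const_mul (DifferentiableAt.sqrt (by fun_prop) ?_) _
    exact hp.ne'
  ext i
  fin_cases i
  · apply grad_coord hd
    have := u_deriv0 hp
    simpa [hw, slideC_same, slideC_ne] using this
  · apply grad_coord hd
    have := u_deriv1 hp
    simpa [hw, slideC_same, slideC_ne] using this
  · apply grad_coord hd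
    have := u_deriv1 (x := x 0) (y := x 2) (c := x 1 ^ 2) (by linarith)
    simpa [hw, slideC_same, slideC_ne, add_comm ((x 1) ^ 2)] using this

section phi

variable {φ : ℝ → ℝ}

lemma phi_aa
    (hφgraph : Ga1 = {p : EuclideanSpace ℝ (Fin 2) | p 0 ∈ Set.Icc (-1 : ℝ) 1 ∧ p 1 = φ (p 0)})
    {x r : ℝ} (hr : 0 < r) (hx : x ^ 2 < r ^ 2) :
    φ (aa x (r ^ 2)) = r * bb x (r ^ 2) := by
  have hp : 0 < x ^ 2 + r ^ 2 := by positivity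
  set s := √(x ^ 2 + r ^ 2) with hsdef
  have hs : s ^ 2 = x ^ 2 + r ^ 2 := sq_sqrt hp.le
  have hs0 : 0 < s := sqrt_pos.2 hp
  have h20 : 0 < √(2 : ℝ) := sqrt_pos.2 (by norm_num)
  have h1 : (x / s) ^ 2 + (r / s) ^ 2 = 1 := by
    rw [div_pow, div_pow, ← add_div, hs, div_self hp.ne']
  have ha : aa (x / s) ((r / s) ^ 2) = aa x (r ^ 2) := by
    unfold aa
    rw [h1, ← hsdef]
    simp
    field_simp
  have hb : r / s * bb (x / s) ((r / s) ^ 2) = r * bb x (r ^ 2) := by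
    unfold bb
    rw [h1, ← hsdef]
    simp
    field_simp
  have hmem : (!₂[aa x (r ^ 2), r * bb x (r ^ 2)] : EuclideanSpace ℝ (Fin 2)) ∈ Ga1 := by
    refine ⟨⟨!₂[x / s, r / s], ?_, ?_⟩, ?_⟩
    · rw [EuclideanSpace.norm_eq]
      simp only [Fin.sum_univ_two, Real.norm_eq_abs, sq_abs]
      simp [h1]
    · rw [grad_w2_s10 (by rw [h1]; norm_num), ha, hb]
    · have habs : |x| < r := abs_lt_of_sq_lt_sq hx hr.le
      simp only [mem_setOf_eq]
      simp
      unfold aa bb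
      rw [abs_div, abs_mul, abs_neg, abs_of_pos (show 0 < x ^ 2 + 3 * r ^ 2 by positivity),
        abs_of_pos (show 0 < √2 * √(x ^ 2 + r ^ 2) ^ 3 by positivity), ← mul_div_assoc]
      gcongr ?_ / _
      have : 0 ≤ (r - |x|) ^ 3 := by
        have : 0 ≤ r - |x| := by linarith
        positivity
      rw [← sq_abs x]
      nlinarith
  rw [hφgraph] at hmem
  have := hmem.2
  simpa using this.symm

lemma dphi_aa
    (hφgraph : Ga1 = {p : EuclideanSpace ℝ (Fin 2) | p 0 ∈ Set.Icc (-1 : ℝ) 1 ∧ p 1 = φ (p 0)})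
    (hφs : ContDiffOn ℝ (⊤ : ℕ∞) φ (Set.Ioo (-1) 1))
    {x r : ℝ} (hr : 0 < r) (hx : x ^ 2 < r ^ 2) :
    deriv φ (aa x (r ^ 2)) = - x / r := by
  have hp : 0 < x ^ 2 + r ^ 2 := by positivity
  have hd : DifferentiableAt ℝ φ (aa x (r ^ 2)) :=
    (hφs.contDiffAt (isOpen_Ioo.mem_nhds (aa_lt hx))).differentiableAt (by simp)
  have h1 := hd.hasDerivAt.comp x (aa_deriv hp)
  have h2 := (bb_deriv hp).const_mul r
  have h3 : (φ ∘ fun t => aa t (r ^ 2)) =ᶠ[nhds x] fun t => r * bb t (r ^ 2) := by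
    have : ∀ᶠ t in nhds x, t ^ 2 < r ^ 2 :=
      (continuous_pow 2).continuousAt.eventually_lt continuousAt_const hx
    filter_upwards [this] with t ht using phi_aa hφgraph hr ht
  have h4 := (h1.congr_of_eventuallyEq h3.symm).unique h2
  have hs0 : 0 < √(x ^ 2 + r ^ 2) := sqrt_pos.2 hp
  have h20 : 0 < √(2 : ℝ) := sqrt_pos.2 (by norm_num)
  have h5 : x ^ 2 - r ^ 2 ≠ 0 := by linarith
  field_simp at h4 ⊢
  linarith

lemma ddphi_aa
    (hφgraph : Ga1 = {p : EuclideanSpace ℝ (Fin 2) | p 0 ∈ Set.Icc (-1 : ℝ) 1 ∧ p 1 = φ (p 0)})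
    (hφs : ContDiffOn ℝ (⊤ : ℕ∞) φ (Set.Ioo (-1) 1))
    {x r : ℝ} (hr : 0 < r) (hx : x ^ 2 < r ^ 2) :
    iteratedDeriv 2 φ (aa x (r ^ 2)) *
      (3 * r ^ 2 * (x ^ 2 - r ^ 2) / (√2 * √(x ^ 2 + r ^ 2) ^ 5)) = - 1 / r := by
  have hp : 0 < x ^ 2 + r ^ 2 := by positivity
  have hd : DifferentiableAt ℝ (deriv φ) (aa x (r ^ 2)) :=
    ((hφs.deriv_of_isOpen (m := (⊤ : ℕ∞)) isOpen_Ioo (by simp)).contDiffAt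
      (isOpen_Ioo.mem_nhds (aa_lt hx))).differentiableAt (by simp)
  have h1 := hd.hasDerivAt.comp x (aa_deriv hp)
  have h2 := (hasDerivAt_id x).neg.div_const r
  have h3 : (deriv φ ∘ fun t => aa t (r ^ 2)) =ᶠ[nhds x] fun t => - t / r := by
    have : ∀ᶠ t in nhds x, t ^ 2 < r ^ 2 :=
      (continuous_pow 2).continuousAt.eventually_lt continuousAt_const hx
    filter_upwards [this] with t ht using dphi_aa hφgraph hφs hr ht
  have h4 := (h1.congr_of_eventuallyEq h3.symm).unique h2
  rw [iteratedDeriv_succ, iteratedDeriv_one]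
  exact h4

end phi

lemma smooth_dd {f : ℝ → ℝ} (hf : ContDiffOn ℝ (⊤ : ℕ∞) f (Set.Ioo (-1) 1)) :
    ContDiffOn ℝ (⊤ : ℕ∞) (iteratedDeriv 2 f) (Set.Ioo (-1) 1) := by
  rw [iteratedDeriv_succ, iteratedDeriv_one]
  exact (hf.deriv_of_isOpen (m := (⊤ : ℕ∞)) isOpen_Ioo (by simp)).deriv_of_isOpen
    isOpen_Ioo (by simp)

/-- Gradient of `G`. -/
lemma grad_G {φ f h : ℝ → ℝ} {G : EuclideanSpace ℝ (Fin 3) → ℝ}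
    (hG : ∀ p : EuclideanSpace ℝ (Fin 3), G p =
      f (p 0) + h (p 0) * (Real.sqrt ((p 1) ^ 2 + (p 2) ^ 2) - φ (p 0)))
    {p : EuclideanSpace ℝ (Fin 3)} (hp : 0 < p 1 ^ 2 + p 2 ^ 2)
    (hf : DifferentiableAt ℝ f (p 0)) (hh : DifferentiableAt ℝ h (p 0))
    (hφ : DifferentiableAt ℝ φ (p 0)) (he : φ (p 0) = √(p 1 ^ 2 + p 2 ^ 2)) :
    gradient G p = !₂[deriv f (p 0) - h (p 0) * deriv φ (p 0),
      h (p 0) * (p 1 / √(p 1 ^ 2 + p 2 ^ 2)), h (p 0) * (p 2 / √(p 1 ^ 2 + p 2 ^ 2))] := by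
  have hd : DifferentiableAt ℝ G p := by
    rw [show G = _ from funext hG]
    have hc : DifferentiableAt ℝ (fun q : EuclideanSpace ℝ (Fin 3) => q 0) p := by fun_prop
    have h1 := DifferentiableAt.comp (g := f) p hf hc
    have h2 := DifferentiableAt.comp (g := h) p hh hc
    have h3 := DifferentiableAt.comp (g := φ) p hφ hc
    have h4 : DifferentiableAt ℝ (fun q : EuclideanSpace ℝ (Fin 3) => √(q 1 ^ 2 + q 2 ^ 2)) p :=
      DifferentiableAt.sqrt (by fun_prop) hp.ne'
    exact h1.add (h2.mul (h4.sub h3))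
  ext i
  fin_cases i
  · apply grad_coord hd
    simp only [hG]
    have := hf.hasDerivAt.fun_add (hh.hasDerivAt.fun_mul (hφ.hasDerivAt.const_sub (√(p 1 ^ 2 + p 2 ^ 2))))
    rw [he] at this
    simpa [slideC_same, slideC_ne, ← sub_eq_add_neg] using this
  · apply grad_coord hd
    simp only [hG]
    have := (((sqrt_add_deriv hp).sub_const (φ (p 0))).const_mul (h (p 0))).const_add (f (p 0))
    simpa [slideC_same, slideC_ne] using this
  · apply grad_coord hd
    simp only [hG]
    rw [add_comm] at hp
    have := (((sqrt_add_deriv hp).sub_const (φ (p 0))).const_mul (h (p 0))).const_add (f (p 0))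
    simpa [slideC_same, slideC_ne, add_comm ((p 1) ^ 2)] using this

/-- The explicit form of the field. -/
def Wf (f h : ℝ → ℝ) (x : EuclideanSpace ℝ (Fin 3)) : EuclideanSpace ℝ (Fin 3) :=
  !₂[deriv f (aa (x 0) (x 1 ^ 2 + x 2 ^ 2)) + 
      h (aa (x 0) (x 1 ^ 2 + x 2 ^ 2)) * (x 0 / √(x 1 ^ 2 + x 2 ^ 2)),
     h (aa (x 0) (x 1 ^ 2 + x 2 ^ 2)) * (x 1 / √(x 1 ^ 2 + x 2 ^ 2)),
     h (aa (x 0) (x 1 ^ 2 + x 2 ^ 2)) * (x 2 / √(x 1 ^ 2 + x 2 ^ 2))]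

lemma isOpen_coneO : IsOpen coneO := by
  unfold coneO
  exact isOpen_lt (by fun_prop) (by fun_prop)

lemma Wf_smooth {f h : ℝ → ℝ} (hf : ContDiffOn ℝ (⊤ : ℕ∞) f (Set.Ioo (-1) 1))
    (hh : ContDiffOn ℝ (⊤ : ℕ∞) h (Set.Ioo (-1) 1)) :
    ContDiffOn ℝ (⊤ : ℕ∞) (Wf f h) coneO := by
  intro x hx
  apply ContDiffAt.contDiffWithinAt
  have hx' : (x 0) ^ 2 < (x 1) ^ 2 + (x 2) ^ 2 := hx
  have hR : 0 < (x 1) ^ 2 + (x 2) ^ 2 := by nlinarith [sq_nonneg (x 0)]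
  have hp : 0 < (x 0) ^ 2 + ((x 1) ^ 2 + (x 2) ^ 2) := by positivity
  have h20 : 0 < √(2 : ℝ) := sqrt_pos.2 (by norm_num)
  have hsp := sqrt_pos.2 hp
  have hsR := sqrt_pos.2 hR
  have c0 : ∀ i : Fin 3, ContDiffAt ℝ (⊤ : ℕ∞) (fun y : EuclideanSpace ℝ (Fin 3) => y i) x := by
    intro i; fun_prop
  have cR : ContDiffAt ℝ (⊤ : ℕ∞) (fun y : EuclideanSpace ℝ (Fin 3) => y 1 ^ 2 + y 2 ^ 2) x :=
    ((c0 1).pow 2).add ((c0 2).pow 2)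
  have cs := cR.sqrt hR.ne'
  have ca : ContDiffAt ℝ (⊤ : ℕ∞)
      (fun y : EuclideanSpace ℝ (Fin 3) => aa (y 0) (y 1 ^ 2 + y 2 ^ 2)) x := by
    unfold aa
    refine ContDiffAt.div ((c0 0).neg.mul (((c0 0).pow 2).add (contDiffAt_const.mul cR))) ?_
      (by positivity)
    exact contDiffAt_const.mul (((((c0 0).pow 2).add cR).sqrt hp.ne').pow 3)
  have mem := isOpen_Ioo.mem_nhds (aa_lt hx')
  have cf := ContDiffAt.comp (g := deriv f) x
    ((hf.deriv_of_isOpen (m := (⊤ : ℕ∞)) isOpen_Ioo (by simp)).contDiffAt mem) ca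
  have ch := ContDiffAt.comp (g := h) x (hh.contDiffAt mem) ca
  rw [contDiffAt_euclidean]
  intro i
  fin_cases i
  · exact cf.add (ch.mul ((c0 0).div cs hsR.ne'))
  · exact ch.mul ((c0 1).div cs hsR.ne')
  · exact ch.mul ((c0 2).div cs hsR.ne')

lemma transversal_deriv {h : ℝ → ℝ} {x y c : ℝ} (hx : x ^ 2 < y ^ 2 + c)
    (hh : DifferentiableAt ℝ h (aa x (y ^ 2 + c))) :
    HasDerivAt (fun t => h (aa x (t ^ 2 + c)) * (t / √(t ^ 2 + c)))
      (deriv h (aa x (y ^ 2 + c)) *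
        (-3 * x * (x ^ 2 - (y ^ 2 + c)) / (√2 * √(x ^ 2 + (y ^ 2 + c)) ^ 5)) *
          (y ^ 2 / √(y ^ 2 + c)) +
        h (aa x (y ^ 2 + c)) * (1 / √(y ^ 2 + c) - y ^ 2 / √(y ^ 2 + c) ^ 3)) y := by
  have hR : 0 < y ^ 2 + c := by nlinarith [sq_nonneg x]
  have hp : 0 < x ^ 2 + (y ^ 2 + c) := by positivity
  have h20 : 0 < √(2 : ℝ) := sqrt_pos.2 (by norm_num)
  have hsp := sqrt_pos.2 hp
  have hsR := sqrt_pos.2 hR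
  have hs : √(y ^ 2 + c) ^ 2 = y ^ 2 + c := sq_sqrt hR.le
  have h0 : HasDerivAt (fun t : ℝ => t ^ 2 + c) (2 * y) y := by
    simpa using ((hasDerivAt_id y).pow 2).add_const c
  have h1 := HasDerivAt.comp y (h₂ := fun S => aa x S) (aa_deriv2 hp) h0
  have h2 := HasDerivAt.comp y (h₂ := h) hh.hasDerivAt h1
  have h3 := (hasDerivAt_id y).div (sqrt_add_deriv hR) hsR.ne'
  refine (h2.mul h3).congr_deriv ?_
  simp only [Function.comp, id, Pi.div_apply]
  generalize deriv h (aa x (y ^ 2 + c)) = A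
  generalize h (aa x (y ^ 2 + c)) = B
  field_simp

lemma coord_deriv {W : ℝ → EuclideanSpace ℝ (Fin 3)} {v : EuclideanSpace ℝ (Fin 3)} {t : ℝ}
    (hW : HasDerivAt W v t) (i : Fin 3) : HasDerivAt (fun s => W s i) (v i) t :=
  (EuclideanSpace.proj (𝕜 := ℝ) i : EuclideanSpace ℝ (Fin 3) →L[ℝ] ℝ).hasFDerivAt.comp_hasDerivAt t hW

lemma Wf_div {f h : ℝ → ℝ} {x : EuclideanSpace ℝ (Fin 3)} (hx : x ∈ coneO)
    (hf : DifferentiableAt ℝ (deriv f) (aa (x 0) (x 1 ^ 2 + x 2 ^ 2)))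
    (hh : DifferentiableAt ℝ h (aa (x 0) (x 1 ^ 2 + x 2 ^ 2)))
    (hW : DifferentiableAt ℝ (Wf f h) x) :
    (∑ i : Fin 3, fderiv ℝ (Wf f h) x (EuclideanSpace.single i 1) i) =
      iteratedDeriv 2 f (aa (x 0) (x 1 ^ 2 + x 2 ^ 2)) *
        (3 * (x 1 ^ 2 + x 2 ^ 2) * (x 0 ^ 2 - (x 1 ^ 2 + x 2 ^ 2)) /
          (√2 * √(x 0 ^ 2 + (x 1 ^ 2 + x 2 ^ 2)) ^ 5)) +
      2 * h (aa (x 0) (x 1 ^ 2 + x 2 ^ 2)) / √(x 1 ^ 2 + x 2 ^ 2) := by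
  have hx' : (x 0) ^ 2 < (x 1) ^ 2 + (x 2) ^ 2 := hx
  have hR : 0 < (x 1) ^ 2 + (x 2) ^ 2 := by nlinarith [sq_nonneg (x 0)]
  have hp : 0 < (x 0) ^ 2 + ((x 1) ^ 2 + (x 2) ^ 2) := by positivity
  have h20 : 0 < √(2 : ℝ) := sqrt_pos.2 (by norm_num)
  have hsp := sqrt_pos.2 hp
  have hsR := sqrt_pos.2 hR
  have e1 := coord_deriv (fderiv_slide hW 1) 1
  have t1 := transversal_deriv hx' hh
  have q1 := e1.unique (by simpa [Wf, slideC_same, slideC_ne] using t1)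
  have e2 := coord_deriv (fderiv_slide hW 2) 2
  have t2 := transversal_deriv (h := h) (x := x 0) (y := x 2) (c := x 1 ^ 2)
    (by rwa [add_comm]) (by rwa [add_comm (x 2 ^ 2)])
  have q2 := e2.unique (by
    simpa [Wf, slideC_same, slideC_ne, add_comm ((x 1) ^ 2)] using t2)
  have e0 := coord_deriv (fderiv_slide hW 0) 0
  have t0 := (HasDerivAt.comp (x 0) (h₂ := deriv f) hf.hasDerivAt (aa_deriv hp)).add
    ((HasDerivAt.comp (x 0) (h₂ := h) hh.hasDerivAt (aa_deriv hp)).mul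
      ((hasDerivAt_id (x 0)).div_const (√(x 1 ^ 2 + x 2 ^ 2))))
  have q0 := e0.unique (by
    refine t0.congr_of_eventuallyEq (Eventually.of_forall fun t => ?_)
    simp [Wf, slideC_same, slideC_ne])
  rw [Fin.sum_univ_three, q0, q1, q2, iteratedDeriv_succ, iteratedDeriv_one,
    add_comm (x 2 ^ 2) (x 1 ^ 2)]
  simp only [Function.comp, id]
  have hs : √(x 1 ^ 2 + x 2 ^ 2) ^ 2 = x 1 ^ 2 + x 2 ^ 2 := sq_sqrt hR.le
  generalize deriv h _ = A
  generalize h _ = B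
  generalize deriv (deriv f) _ = C
  generalize √(x 0 ^ 2 + _) = s at *
  generalize √(x 1 ^ 2 + _) = r at *
  have : x 1 ^ 2 = r ^ 2 - x 2 ^ 2 := by linarith
  rw [this]
  field_simp
  ring

/-- If `h = f''/(2φ'')` and `G(p) = f(p₁) + h(p₁)(√(p₂²+p₃²) − φ(p₁))`, then
`V = ∇G(∇u₀)` is smooth on the cone `O = {x₁² < x₂² + x₃²}` and `div V = 0` there. -/
theorem statement10 (φ : ℝ → ℝ)
    (hφc : ContinuousOn φ (Set.Icc (-1) 1))
    (hφgraph : Ga1 = {p : EuclideanSpace ℝ (Fin 2) | p 0 ∈ Set.Icc (-1 : ℝ) 1 ∧ p 1 = φ (p 0)})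
    (hφs : ContDiffOn ℝ (⊤ : ℕ∞) φ (Set.Ioo (-1) 1))
    (hφ'' : ∀ x ∈ Set.Ioo (-1 : ℝ) 1, 0 < iteratedDeriv 2 φ x)
    (f : ℝ → ℝ) (hf : ContDiffOn ℝ (⊤ : ℕ∞) f (Set.Ioo (-1) 1))
    (h : ℝ → ℝ) (hh : ∀ x ∈ Set.Ioo (-1 : ℝ) 1, h x = iteratedDeriv 2 f x / (2 * iteratedDeriv 2 φ x))
    (G : EuclideanSpace ℝ (Fin 3) → ℝ)
    (hG : ∀ p : EuclideanSpace ℝ (Fin 3), G p =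
      f (p 0) + h (p 0) * (Real.sqrt ((p 1) ^ 2 + (p 2) ^ 2) - φ (p 0))) :
    ContDiffOn ℝ (⊤ : ℕ∞) (fun x => gradient G (gradient u0 x)) coneO ∧
    ∀ x ∈ coneO,
      (∑ i : Fin 3,
        fderiv ℝ (fun y => gradient G (gradient u0 y)) x (EuclideanSpace.single i 1) i) = 0 := by
  have hhs : ContDiffOn ℝ (⊤ : ℕ∞) h (Set.Ioo (-1) 1) := by
    refine ContDiffOn.congr ?_ hh
    refine (smooth_dd hf).div (contDiffOn_const.mul (smooth_dd hφs)) ?_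
    intro t ht
    have := hφ'' t ht
    positivity
  have hW := Wf_smooth hf hhs
  have heq : ∀ x ∈ coneO, gradient G (gradient u0 x) = Wf f h x := by
    intro x hx
    have hx' : (x 0) ^ 2 < (x 1) ^ 2 + (x 2) ^ 2 := hx
    have hR : 0 < (x 1) ^ 2 + (x 2) ^ 2 := by nlinarith [sq_nonneg (x 0)]
    have hp : 0 < (x 0) ^ 2 + ((x 1) ^ 2 + (x 2) ^ 2) := by positivity
    have h20 : 0 < √(2 : ℝ) := sqrt_pos.2 (by norm_num)
    have hsp := sqrt_pos.2 hp
    have hsR := sqrt_pos.2 hR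
    have hs : √(x 1 ^ 2 + x 2 ^ 2) ^ 2 = x 1 ^ 2 + x 2 ^ 2 := sq_sqrt hR.le
    have mem := isOpen_Ioo.mem_nhds (aa_lt hx')
    have k1 := phi_aa (x := x 0) hφgraph hsR (by rwa [hs])
    have k2 := dphi_aa (x := x 0) hφgraph hφs hsR (by rwa [hs])
    rw [hs] at k1 k2
    have hb : 0 < bb (x 0) (x 1 ^ 2 + x 2 ^ 2) := by unfold bb; positivity
    have hn : (x 1 * bb (x 0) (x 1 ^ 2 + x 2 ^ 2)) ^ 2 + (x 2 * bb (x 0) (x 1 ^ 2 + x 2 ^ 2)) ^ 2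
        = (x 1 ^ 2 + x 2 ^ 2) * bb (x 0) (x 1 ^ 2 + x 2 ^ 2) ^ 2 := by ring
    have hn2 : √((x 1 * bb (x 0) (x 1 ^ 2 + x 2 ^ 2)) ^ 2 +
        (x 2 * bb (x 0) (x 1 ^ 2 + x 2 ^ 2)) ^ 2)
        = √(x 1 ^ 2 + x 2 ^ 2) * bb (x 0) (x 1 ^ 2 + x 2 ^ 2) := by
      rw [hn, Real.sqrt_mul hR.le, Real.sqrt_sq hb.le]
    rw [grad_u0 hx]
    rw [grad_G hG]
    · simp only [Wf]
      simp [hn2, k2]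
      refine ⟨?_, ?_, ?_⟩
      · ring
      · left; field_simp
      · left; field_simp
    · simp only [PiLp.toLp_apply, Matrix.cons_val]
      rw [hn]; positivity
    · exact (hf.contDiffAt mem).differentiableAt (by simp)
    · exact (hhs.contDiffAt mem).differentiableAt (by simp)
    · exact (hφs.contDiffAt mem).differentiableAt (by simp)
    · simp only [PiLp.toLp_apply, Matrix.cons_val]
      rw [hn2, ← k1]
  refine ⟨hW.congr heq, ?_⟩
  intro x hx
  have hx' : (x 0) ^ 2 < (x 1) ^ 2 + (x 2) ^ 2 := hx
  have hR : 0 < (x 1) ^ 2 + (x 2) ^ 2 := by nlinarith [sq_nonneg (x 0)]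
  have hsR := sqrt_pos.2 hR
  have hs : √(x 1 ^ 2 + x 2 ^ 2) ^ 2 = x 1 ^ 2 + x 2 ^ 2 := sq_sqrt hR.le
  have mem := isOpen_Ioo.mem_nhds (aa_lt hx')
  have hev : (fun y => gradient G (gradient u0 y)) =ᶠ[nhds x] Wf f h := by
    filter_upwards [isOpen_coneO.mem_nhds hx] with y hy using heq y hy
  rw [hev.fderiv_eq]
  rw [Wf_div hx]
  · have k3 := ddphi_aa (x := x 0) hφgraph hφs hsR (by rwa [hs])
    rw [hs] at k3
    have hpos := hφ'' _ (aa_lt hx')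
    have hhx := hh _ (aa_lt hx')
    have hfe : iteratedDeriv 2 f (aa (x 0) (x 1 ^ 2 + x 2 ^ 2)) =
        2 * h (aa (x 0) (x 1 ^ 2 + x 2 ^ 2)) *
          iteratedDeriv 2 φ (aa (x 0) (x 1 ^ 2 + x 2 ^ 2)) := by
      rw [hhx]; field_simp
    rw [hfe, mul_assoc, k3]
    ring
  · exact ((hf.deriv_of_isOpen (m := (⊤ : ℕ∞)) isOpen_Ioo (by simp)).contDiffAt
      mem).differentiableAt (by simp)
  · exact (hhs.contDiffAt mem).differentiableAt (by simp)
  · exact (hW.contDiffAt (isOpen_coneO.mem_nhds hx)).differentiableAt (by simp)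
end
end
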